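/- arXiv:math/0003195 — 3 statements merged into one kernel-verified Lean document; each statement's English description precedes it below -/
import Mathlib

section
/- Let F_q be a finite field with q elements, let s_M(n,q) be the number of n×n matrices over F_q with squarefree characteristic polynomial divided by q^{n²}, and let |GL(n,q)| = ∏_{i=0}^{n−1}(q^n − q^i). Let p(d) denote the number of partitions of the integer d (with p(d) = 0 for d < 0) and p₂(d) = ∑_{i=0}^d p(i). Then for every n ≥ 1, |s_M(n,q) · q^{n²}/|GL(n,q)| − 1| ≤ ∑_{d=n+1}^∞ (p₂(d) + q·p(d−2)) q^{−d} ≤ (1/3)·((4q+27)/(2q−3))·(2q/3)^{−n}. -/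
/-- Proportion of separable `n × n` matrices (squarefree characteristic polynomial)
over the finite field `F`, i.e. their number divided by `q^{n²}`. -/
noncomputable def separableProportion (F : Type) [Field F] [Fintype F] (n : ℕ) : ℝ :=
  (Nat.card {A : Matrix (Fin n) (Fin n) F // Squarefree A.charpoly} : ℝ) /
    (Fintype.card F : ℝ) ^ (n ^ 2)

/-- `p(d)`, the number of partitions of `d`. -/
def numPartitions (d : ℕ) : ℕ := Fintype.card (Nat.Partition d)

/-- `p₂(d) = ∑_{i=0}^d p(i)`. -/
def numPartitionsCumulative (d : ℕ) : ℕ := ∑ i ∈ Finset.range (d + 1), numPartitions i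


/-- `∑_{j ≥ 1} X^{dj}`. -/
noncomputable def sepRp (d : ℕ) : PowerSeries ℝ :=
  PowerSeries.mk fun k => if k ≠ 0 ∧ d ∣ k then 1 else 0

/-- partition generating function -/
noncomputable def sepP : PowerSeries ℝ := PowerSeries.mk fun k => (numPartitions k : ℝ)

theorem sepRp_mul (d : ℕ) (hd : 1 ≤ d) :
    (1 - (PowerSeries.X : PowerSeries ℝ) ^ d) * sepRp d = PowerSeries.X ^ d := by
  ext n
  rw [sub_mul, one_mul, map_sub, PowerSeries.coeff_X_pow_mul', PowerSeries.coeff_X_pow]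
  simp only [sepRp, PowerSeries.coeff_mk]
  by_cases h : n = d
  · subst h; simp; omega
  · by_cases h2 : d ≤ n
    · have : n - d ≠ 0 := by omega
      have h3 : d ∣ n - d ↔ d ∣ n := by
        rw [← Nat.dvd_sub_iff_left h2 (dvd_refl d)]
      have h4 : n ≠ 0 := by omega
      simp [h, h2, this, h3, h4]
    · have : ¬ (n ≠ 0 ∧ d ∣ n) := fun ⟨h5, h6⟩ => h2 (Nat.le_of_dvd (by omega) h6)
      rw [if_neg this]; simp [h, h2]

/-- total number of parts equal to `i` among partitions of `n` -/
def sepC (n i : ℕ) : ℕ := ∑ l : Nat.Partition n, l.parts.count i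

theorem sepC_rec (n i : ℕ) (hi : 1 ≤ i) :
    sepC n i = if i ≤ n then numPartitions (n - i) + sepC (n - i) i else 0 := by
  split_ifs with h
  · unfold sepC numPartitions
    have h1 : ∑ l : Nat.Partition n, l.parts.count i
        = ∑ l : {l : Nat.Partition n // i ∈ l.parts}, l.1.parts.count i := by
      rw [← Finset.sum_filter_of_ne (p := fun l : Nat.Partition n => i ∈ l.parts)
        (fun l _ hl => Multiset.count_ne_zero.mp hl)]
      exact Finset.sum_subtype _ (by simp) _
    rw [h1, ← (Nat.Partition.partitionWithPartEquiv hi h).symm.sum_comp]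
    simp [Finset.sum_add_distrib, add_comm]
  · unfold sepC
    apply Finset.sum_eq_zero
    intro l _
    rw [Multiset.count_eq_zero]
    intro hm
    exact h (Nat.Partition.le_of_mem_parts hm)

theorem sepC_ps (i : ℕ) (hi : 1 ≤ i) :
    PowerSeries.mk (fun n => (sepC n i : ℝ)) = sepRp i * sepP := by
  have h1 : (1 - (PowerSeries.X : PowerSeries ℝ) ^ i) * PowerSeries.mk (fun n => (sepC n i : ℝ))
      = PowerSeries.X ^ i * sepP := by
    ext n
    rw [sub_mul, one_mul, map_sub, PowerSeries.coeff_X_pow_mul', PowerSeries.coeff_X_pow_mul',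
      PowerSeries.coeff_mk, sepC_rec n i hi]
    split_ifs <;> simp [sepP]
  have h2 : (1 - (PowerSeries.X : PowerSeries ℝ) ^ i) ≠ 0 := by
    intro h
    have := congrArg (PowerSeries.constantCoeff) h
    have h0 : i ≠ 0 := by omega
    simp [h0] at this
  apply mul_left_cancel₀ h2
  rw [h1, ← mul_assoc, sepRp_mul i hi]

theorem sep_euler (n : ℕ) : (n : ℝ) * numPartitions n =
    ∑ x ∈ Finset.HasAntidiagonal.antidiagonal n, (∑ i ∈ x.1.divisors, (i : ℝ)) * numPartitions x.2 := by
  have h1 : n * numPartitions n = ∑ i ∈ Finset.Icc 1 n, i * sepC n i := by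
    unfold sepC numPartitions
    simp_rw [Finset.mul_sum]
    rw [Finset.sum_comm]
    have : ∀ l : Nat.Partition n, ∑ i ∈ Finset.Icc 1 n, i * l.parts.count i = n := by
      intro l
      conv_rhs => rw [← l.parts_sum]
      rw [Finset.sum_multiset_count_of_subset l.parts (Finset.Icc 1 n)]
      · simp [mul_comm]
      · intro x hx
        rw [Multiset.mem_toFinset] at hx
        rw [Finset.mem_Icc]
        exact ⟨l.parts_pos hx, Nat.Partition.le_of_mem_parts hx⟩
    simp_rw [this]
    simp [mul_comm]
  have h2 : ∀ i ∈ Finset.Icc 1 n, (i : ℝ) * sepC n i =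
      ∑ x ∈ Finset.HasAntidiagonal.antidiagonal n, (if x.1 ≠ 0 ∧ i ∣ x.1 then (i : ℝ) else 0) * numPartitions x.2 := by
    intro i hi
    have := congrArg (PowerSeries.coeff n) (sepC_ps i (Finset.mem_Icc.mp hi).1)
    rw [PowerSeries.coeff_mk, PowerSeries.coeff_mul] at this
    rw [this, Finset.mul_sum]
    apply Finset.sum_congr rfl
    intro x _
    simp [sepRp, sepP]
  have h3 := congrArg (Nat.cast : ℕ → ℝ) h1
  push_cast at h3
  rw [h3, Finset.sum_congr rfl h2, Finset.sum_comm]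
  apply Finset.sum_congr rfl
  intro x hx
  rw [← Finset.sum_mul]
  congr 1
  rw [← Finset.sum_filter]
  apply Finset.sum_congr _ (fun _ _ => rfl)
  ext i
  rw [Finset.HasAntidiagonal.mem_antidiagonal] at hx
  simp only [Finset.mem_filter, Finset.mem_Icc, Nat.mem_divisors]
  constructor
  · rintro ⟨_, h, h'⟩; exact ⟨h', h⟩
  · rintro ⟨h, h'⟩
    have := Nat.le_of_dvd (by omega) h
    have := Nat.pos_of_dvd_of_pos h (by omega)
    exact ⟨⟨by omega, by omega⟩, h', h⟩

theorem sep_euler_nat (n : ℕ) : n * numPartitions n =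
    ∑ k ∈ Finset.range n, (∑ i ∈ (k + 1).divisors, i) * numPartitions (n - (k + 1)) := by
  have h := sep_euler n
  rw [Finset.Nat.sum_antidiagonal_eq_sum_range_succ
    (fun a b => (∑ i ∈ a.divisors, (i : ℝ)) * (numPartitions b : ℝ)), Finset.sum_range_succ'] at h
  simp only [Nat.divisors_zero, Finset.sum_empty, zero_mul, add_zero] at h
  apply Nat.cast_injective (R := ℝ)
  push_cast
  exact h

theorem sep_p_small_aux (p : ℕ → ℕ) (p0 : p 0 = 1) (hp : ∀ n, n * p n =
    ∑ k ∈ Finset.range n, (∑ i ∈ (k + 1).divisors, i) * p (n - (k + 1)))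
    (n : ℕ) (hn : n < 18) : (p n : ℝ) ≤ (3 / 2 : ℝ) ^ n := by
  have s1 : ∑ i ∈ Nat.divisors 1, i = 1 := by rfl
  have s2 : ∑ i ∈ Nat.divisors 2, i = 3 := by rfl
  have s3 : ∑ i ∈ Nat.divisors 3, i = 4 := by rfl
  have s4 : ∑ i ∈ Nat.divisors 4, i = 7 := by rfl
  have s5 : ∑ i ∈ Nat.divisors 5, i = 6 := by rfl
  have s6 : ∑ i ∈ Nat.divisors 6, i = 12 := by rfl
  have s7 : ∑ i ∈ Nat.divisors 7, i = 8 := by rfl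
  have s8 : ∑ i ∈ Nat.divisors 8, i = 15 := by rfl
  have s9 : ∑ i ∈ Nat.divisors 9, i = 13 := by rfl
  have s10 : ∑ i ∈ Nat.divisors 10, i = 18 := by rfl
  have s11 : ∑ i ∈ Nat.divisors 11, i = 12 := by rfl
  have s12 : ∑ i ∈ Nat.divisors 12, i = 28 := by rfl
  have s13 : ∑ i ∈ Nat.divisors 13, i = 14 := by rfl
  have s14 : ∑ i ∈ Nat.divisors 14, i = 24 := by rfl
  have s15 : ∑ i ∈ Nat.divisors 15, i = 24 := by rfl
  have s16 : ∑ i ∈ Nat.divisors 16, i = 31 := by rfl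
  have s17 : ∑ i ∈ Nat.divisors 17, i = 18 := by rfl
  have p1 : p 1 = 1 := by
    have h := hp 1
    simp only [Finset.sum_range_succ, Finset.sum_range_zero, s1, p0, Nat.reduceAdd, Nat.reduceSub, zero_add] at h
    omega
  have p2 : p 2 = 2 := by
    have h := hp 2
    simp only [Finset.sum_range_succ, Finset.sum_range_zero, s1, s2, p0, p1, Nat.reduceAdd, Nat.reduceSub, zero_add] at h
    omega
  have p3 : p 3 = 3 := by
    have h := hp 3
    simp only [Finset.sum_range_succ, Finset.sum_range_zero, s1, s2, s3, p0, p1, p2, Nat.reduceAdd, Nat.reduceSub, zero_add] at h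
    omega
  have p4 : p 4 = 5 := by
    have h := hp 4
    simp only [Finset.sum_range_succ, Finset.sum_range_zero, s1, s2, s3, s4, p0, p1, p2, p3, Nat.reduceAdd, Nat.reduceSub, zero_add] at h
    omega
  have p5 : p 5 = 7 := by
    have h := hp 5
    simp only [Finset.sum_range_succ, Finset.sum_range_zero, s1, s2, s3, s4, s5, p0, p1, p2, p3, p4, Nat.reduceAdd, Nat.reduceSub, zero_add] at h
    omega
  have p6 : p 6 = 11 := by
    have h := hp 6
    simp only [Finset.sum_range_succ, Finset.sum_range_zero, s1, s2, s3, s4, s5, s6, p0, p1, p2, p3, p4, p5, Nat.reduceAdd, Nat.reduceSub, zero_add] at h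
    omega
  have p7 : p 7 = 15 := by
    have h := hp 7
    simp only [Finset.sum_range_succ, Finset.sum_range_zero, s1, s2, s3, s4, s5, s6, s7, p0, p1, p2, p3, p4, p5, p6, Nat.reduceAdd, Nat.reduceSub, zero_add] at h
    omega
  have p8 : p 8 = 22 := by
    have h := hp 8
    simp only [Finset.sum_range_succ, Finset.sum_range_zero, s1, s2, s3, s4, s5, s6, s7, s8, p0, p1, p2, p3, p4, p5, p6, p7, Nat.reduceAdd, Nat.reduceSub, zero_add] at h
    omega
  have p9 : p 9 = 30 := by
    have h := hp 9
    simp only [Finset.sum_range_succ, Finset.sum_range_zero, s1, s2, s3, s4, s5, s6, s7, s8, s9, p0, p1, p2, p3, p4, p5, p6, p7, p8, Nat.reduceAdd, Nat.reduceSub, zero_add] at h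
    omega
  have p10 : p 10 = 42 := by
    have h := hp 10
    simp only [Finset.sum_range_succ, Finset.sum_range_zero, s1, s2, s3, s4, s5, s6, s7, s8, s9, s10, p0, p1, p2, p3, p4, p5, p6, p7, p8, p9, Nat.reduceAdd, Nat.reduceSub, zero_add] at h
    omega
  have p11 : p 11 = 56 := by
    have h := hp 11
    simp only [Finset.sum_range_succ, Finset.sum_range_zero, s1, s2, s3, s4, s5, s6, s7, s8, s9, s10, s11, p0, p1, p2, p3, p4, p5, p6, p7, p8, p9, p10, Nat.reduceAdd, Nat.reduceSub, zero_add] at h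
    omega
  have p12 : p 12 = 77 := by
    have h := hp 12
    simp only [Finset.sum_range_succ, Finset.sum_range_zero, s1, s2, s3, s4, s5, s6, s7, s8, s9, s10, s11, s12, p0, p1, p2, p3, p4, p5, p6, p7, p8, p9, p10, p11, Nat.reduceAdd, Nat.reduceSub, zero_add] at h
    omega
  have p13 : p 13 = 101 := by
    have h := hp 13
    simp only [Finset.sum_range_succ, Finset.sum_range_zero, s1, s2, s3, s4, s5, s6, s7, s8, s9, s10, s11, s12, s13, p0, p1, p2, p3, p4, p5, p6, p7, p8, p9, p10, p11, p12, Nat.reduceAdd, Nat.reduceSub, zero_add] at h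
    omega
  have p14 : p 14 = 135 := by
    have h := hp 14
    simp only [Finset.sum_range_succ, Finset.sum_range_zero, s1, s2, s3, s4, s5, s6, s7, s8, s9, s10, s11, s12, s13, s14, p0, p1, p2, p3, p4, p5, p6, p7, p8, p9, p10, p11, p12, p13, Nat.reduceAdd, Nat.reduceSub, zero_add] at h
    omega
  have p15 : p 15 = 176 := by
    have h := hp 15
    simp only [Finset.sum_range_succ, Finset.sum_range_zero, s1, s2, s3, s4, s5, s6, s7, s8, s9, s10, s11, s12, s13, s14, s15, p0, p1, p2, p3, p4, p5, p6, p7, p8, p9, p10, p11, p12, p13, p14, Nat.reduceAdd, Nat.reduceSub, zero_add] at h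
    omega
  have p16 : p 16 = 231 := by
    have h := hp 16
    simp only [Finset.sum_range_succ, Finset.sum_range_zero, s1, s2, s3, s4, s5, s6, s7, s8, s9, s10, s11, s12, s13, s14, s15, s16, p0, p1, p2, p3, p4, p5, p6, p7, p8, p9, p10, p11, p12, p13, p14, p15, Nat.reduceAdd, Nat.reduceSub, zero_add] at h
    omega
  have p17 : p 17 = 297 := by
    have h := hp 17
    simp only [Finset.sum_range_succ, Finset.sum_range_zero, s1, s2, s3, s4, s5, s6, s7, s8, s9, s10, s11, s12, s13, s14, s15, s16, s17, p0, p1, p2, p3, p4, p5, p6, p7, p8, p9, p10, p11, p12, p13, p14, p15, p16, Nat.reduceAdd, Nat.reduceSub, zero_add] at h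
    omega
  interval_cases n <;> simp only [p0, p1, p2, p3, p4, p5, p6, p7, p8, p9, p10, p11, p12, p13, p14, p15, p16, p17] <;> norm_num

theorem sep_p_small (n : ℕ) (hn : n < 18) : (numPartitions n : ℝ) ≤ (3 / 2 : ℝ) ^ n :=
  sep_p_small_aux _ (by unfold numPartitions; simp) sep_euler_nat n hn

theorem sep_sigma_le (k : ℕ) : (∑ i ∈ k.divisors, (i : ℝ)) ≤ k * (k + 1) / 2 := by
  have h1 : (∑ i ∈ k.divisors, (i : ℝ)) ≤ ∑ i ∈ Finset.range (k + 1), (i : ℝ) := by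
    apply Finset.sum_le_sum_of_subset_of_nonneg
    · intro i hi
      have := Nat.divisor_le hi
      simp; omega
    · intros; positivity
  have h2 : ∀ k : ℕ, ∑ i ∈ Finset.range (k + 1), (i : ℝ) = k * (k + 1) / 2 := by
    intro k
    induction k with
    | zero => simp
    | succ m ih => rw [Finset.sum_range_succ, ih]; push_cast; ring
  linarith [h2 k]

theorem sep_sigma_sum (n : ℕ) :
    ∑ k ∈ Finset.range (n + 1), ((k : ℝ) * (k + 1) / 2) * (2 / 3 : ℝ) ^ k
      = 18 - ((n : ℝ) ^ 2 + 7 * n + 18) * (2 / 3 : ℝ) ^ n := by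
  induction n with
  | zero => simp
  | succ m ih => rw [Finset.sum_range_succ, ih]; push_cast; ring

theorem sep_p_le (n : ℕ) : (numPartitions n : ℝ) ≤ (3 / 2 : ℝ) ^ n := by
  induction n using Nat.strong_induction_on with
  | _ n ih =>
    by_cases hn : n < 18
    · exact sep_p_small n hn
    have h := sep_euler n
    rw [Finset.Nat.sum_antidiagonal_eq_sum_range_succ
      (fun a b => (∑ i ∈ a.divisors, (i : ℝ)) * (numPartitions b : ℝ))] at h
    have h1 : ∑ k ∈ Finset.range n.succ, (∑ i ∈ k.divisors, (i : ℝ)) * (numPartitions (n - k) : ℝ)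
        ≤ ∑ k ∈ Finset.range (n + 1), (((k : ℝ) * (k + 1) / 2) * (2 / 3 : ℝ) ^ k) * (3 / 2 : ℝ) ^ n := by
      apply Finset.sum_le_sum
      intro k hk
      rw [Finset.mem_range] at hk
      rcases Nat.eq_zero_or_pos k with h0 | h0
      · subst h0; simp
      · have e : (2 / 3 : ℝ) ^ k * (3 / 2 : ℝ) ^ n = (3 / 2 : ℝ) ^ (n - k) := by
          obtain ⟨m, rfl⟩ : ∃ m, n = k + m := ⟨n - k, by omega⟩
          rw [pow_add, ← mul_assoc, ← mul_pow]; norm_num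
        rw [mul_assoc, e]
        exact mul_le_mul (sep_sigma_le k) (ih _ (by omega)) (by positivity) (by positivity)
    rw [← Finset.sum_mul, sep_sigma_sum] at h1
    have h2 : (18 - ((n : ℝ) ^ 2 + 7 * n + 18) * (2 / 3 : ℝ) ^ n) ≤ n := by
      have : (18 : ℝ) ≤ n := by exact_mod_cast (not_lt.mp hn)
      have : 0 ≤ ((n : ℝ) ^ 2 + 7 * n + 18) * (2 / 3 : ℝ) ^ n := by positivity
      linarith
    have h3 : (n : ℝ) * numPartitions n ≤ n * (3 / 2 : ℝ) ^ n := by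
      rw [h]
      exact h1.trans (mul_le_mul_of_nonneg_right h2 (by positivity))
    exact le_of_mul_le_mul_left h3 (by exact_mod_cast (by omega : 0 < n))

theorem sep_p2_le (n : ℕ) : (numPartitionsCumulative n : ℝ) ≤ 3 * (3 / 2 : ℝ) ^ n := by
  have : (numPartitionsCumulative n : ℝ) ≤ 3 * (3 / 2 : ℝ) ^ n - 2 := by
    unfold numPartitionsCumulative
    push_cast
    induction n with
    | zero => have := sep_p_le 0; simp only [pow_zero] at this; simp; linarith
    | succ m ih =>
      rw [Finset.sum_range_succ]
      have := sep_p_le (m + 1)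
      rw [pow_succ] at this ⊢
      linarith
  linarith


/-- coefficientwise majorization -/
def sepMaj (A B : PowerSeries ℝ) : Prop := ∀ n, |PowerSeries.coeff n A| ≤ PowerSeries.coeff n B

theorem sepMaj.nonneg {A B : PowerSeries ℝ} (h : sepMaj A B) (n : ℕ) :
    0 ≤ PowerSeries.coeff n B := (abs_nonneg _).trans (h n)

theorem sepMaj.mul {A B A' B' : PowerSeries ℝ} (h : sepMaj A B) (h' : sepMaj A' B') :
    sepMaj (A * A') (B * B') := by
  intro n
  rw [PowerSeries.coeff_mul, PowerSeries.coeff_mul]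
  refine (Finset.abs_sum_le_sum_abs _ _).trans (Finset.sum_le_sum fun x _ => ?_)
  rw [abs_mul]
  exact mul_le_mul (h _) (h' _) (abs_nonneg _) (h.nonneg _)

theorem sepMaj.add {A B A' B' : PowerSeries ℝ} (h : sepMaj A B) (h' : sepMaj A' B') :
    sepMaj (A + A') (B + B') := by
  intro n
  rw [map_add, map_add]
  exact (abs_add_le _ _).trans (add_le_add (h _) (h' _))

theorem sepMaj.trans {A B C : PowerSeries ℝ} (h : sepMaj A B) (h' : sepMaj B C) :
    sepMaj A C := fun n => (h n).trans ((le_abs_self _).trans (h' n))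

theorem sepMaj_one : sepMaj 1 1 := by
  intro n
  rw [PowerSeries.coeff_one]; split_ifs <;> simp

theorem sepMaj.prod {ι : Type*} (T : Finset ι) (A B : ι → PowerSeries ℝ)
    (h : ∀ i ∈ T, sepMaj (A i) (B i)) : sepMaj (∏ i ∈ T, A i) (∏ i ∈ T, B i) := by
  classical
  induction T using Finset.induction_on with
  | empty => simpa using sepMaj_one
  | insert a s ha ih =>
    rw [Finset.prod_insert ha, Finset.prod_insert ha]
    exact (h a (by simp)).mul (ih fun i hi => h i (by simp [hi]))

/-- `θ = X d/dX` -/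
noncomputable def sepTheta (A : PowerSeries ℝ) : PowerSeries ℝ :=
  PowerSeries.X * PowerSeries.derivative ℝ A

theorem coeff_sepTheta (A : PowerSeries ℝ) (n : ℕ) :
    PowerSeries.coeff n (sepTheta A) = n * PowerSeries.coeff n A := by
  cases n with
  | zero => simp [sepTheta]
  | succ m =>
    rw [sepTheta, PowerSeries.coeff_succ_X_mul, PowerSeries.coeff_derivative]
    push_cast; ring

theorem sepTheta_mul (A B : PowerSeries ℝ) :
    sepTheta (A * B) = sepTheta A * B + A * sepTheta B := by
  simp only [sepTheta, Derivation.leibniz, smul_eq_mul]; ring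

theorem sepMaj_self_of_nonneg {A : PowerSeries ℝ} (h : ∀ n, 0 ≤ PowerSeries.coeff n A) :
    sepMaj A A := fun n => by rw [abs_of_nonneg (h n)]

theorem sepRp_nonneg (d n : ℕ) : 0 ≤ PowerSeries.coeff n (sepRp d) := by
  simp only [sepRp, PowerSeries.coeff_mk]; split_ifs <;> norm_num

theorem sep_one_add_nonneg (e : ℝ) (he : 0 ≤ e) (d n : ℕ) :
    0 ≤ PowerSeries.coeff n (1 + PowerSeries.C e * sepRp d) := by
  rw [map_add, PowerSeries.coeff_C_mul]
  have h1 : 0 ≤ PowerSeries.coeff n (1 : PowerSeries ℝ) := sepMaj_one.nonneg n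
  have := sepRp_nonneg d n
  positivity

theorem sep_one_add_maj (e : ℝ) (he : 0 ≤ e) (d : ℕ) :
    sepMaj (1 + PowerSeries.C e * sepRp d) (1 + PowerSeries.C e * sepRp d) :=
  sepMaj_self_of_nonneg (sep_one_add_nonneg e he d)

theorem sep_prod_theta {ι : Type*} (T : Finset ι) (e : ι → ℝ) (d : ι → ℕ) (he : ∀ i, 0 ≤ e i) :
    sepMaj (sepTheta (∏ i ∈ T, (1 + PowerSeries.C (e i) * sepRp (d i))))
      ((∑ i ∈ T, PowerSeries.C (e i) * sepTheta (sepRp (d i))) *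
        ∏ i ∈ T, (1 + PowerSeries.C (e i) * sepRp (d i))) := by
  classical
  induction T using Finset.induction_on with
  | empty =>
    intro n
    simp [coeff_sepTheta, PowerSeries.coeff_one]
  | insert a s ha ih =>
    rw [Finset.prod_insert ha, Finset.sum_insert ha, sepTheta_mul]
    set W := ∏ i ∈ s, (1 + PowerSeries.C (e i) * sepRp (d i)) with hW
    set Y := (1 + PowerSeries.C (e a) * sepRp (d a)) with hY
    set S := ∑ i ∈ s, PowerSeries.C (e i) * sepTheta (sepRp (d i)) with hS
    have hWW : sepMaj W W := sepMaj.prod _ _ _ fun i _ => sep_one_add_maj _ (he i) _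
    have hYY : sepMaj Y Y := sep_one_add_maj _ (he a) _
    have hY1 : sepMaj 1 Y := by
      intro n
      rw [hY, map_add, PowerSeries.coeff_C_mul, abs_of_nonneg (sepMaj_one.nonneg n)]
      have := mul_nonneg (he a) (sepRp_nonneg (d a) n)
      linarith
    have hθ : sepTheta Y = PowerSeries.C (e a) * sepTheta (sepRp (d a)) := by
      ext n
      rw [coeff_sepTheta, PowerSeries.coeff_C_mul, coeff_sepTheta, hY, map_add,
        PowerSeries.coeff_C_mul, PowerSeries.coeff_one]
      split_ifs with h
      · subst h; simp
      · ring
    have hθM : sepMaj (sepTheta Y) (sepTheta Y) := by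
      apply sepMaj_self_of_nonneg
      intro n
      rw [coeff_sepTheta]
      exact mul_nonneg (by positivity) (sep_one_add_nonneg _ (he a) _ _)
    rw [← hθ]
    have h1 : sepMaj (sepTheta Y * W) (sepTheta Y * (Y * W)) := by
      have := (hθM.mul (hY1.mul hWW)); rwa [one_mul] at this
    have h2 := hYY.mul ih
    have := h1.add h2
    convert this using 1
    ring

theorem sep_W_le {ι : Type*} (T : Finset ι) (d : ι → ℕ) (q : ℕ) (hq : 2 ≤ q)
    (hT : ∀ m : ℕ, 1 ≤ m → (m : ℝ) * (T.filter fun i => d i = m).card ≤ (q : ℝ) ^ m - 1) (n : ℕ) :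
    PowerSeries.coeff n (∏ i ∈ T, (1 + PowerSeries.C (((q : ℝ) ^ d i - 1)⁻¹) * sepRp (d i)))
      ≤ (numPartitions n : ℝ) := by
  have hq1 : (1 : ℝ) ≤ q := by exact_mod_cast (by omega : 1 ≤ q)
  have hq2 : (1 : ℝ) < q := by exact_mod_cast (by omega : 1 < q)
  have he : ∀ i, 0 ≤ ((q : ℝ) ^ d i - 1)⁻¹ := fun i =>
    inv_nonneg.mpr (by linarith [one_le_pow₀ hq1 (n := d i)])
  have hmaj := sep_prod_theta T (fun i => ((q : ℝ) ^ d i - 1)⁻¹) d he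
  set W := ∏ i ∈ T, (1 + PowerSeries.C (((q : ℝ) ^ d i - 1)⁻¹) * sepRp (d i)) with hW
  have hWnn : ∀ n, 0 ≤ PowerSeries.coeff n W :=
    (sepMaj.prod T _ _ fun i _ => sep_one_add_maj _ (he i) _).nonneg
  have hS : ∀ k, PowerSeries.coeff k (∑ i ∈ T, PowerSeries.C (((q : ℝ) ^ d i - 1)⁻¹) *
      sepTheta (sepRp (d i))) ≤ ∑ i ∈ k.divisors, (i : ℝ) := by
    intro k
    rw [map_sum]
    simp_rw [PowerSeries.coeff_C_mul, coeff_sepTheta, sepRp, PowerSeries.coeff_mk]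
    rcases Nat.eq_zero_or_pos k with h0 | h0
    · subst h0; simp
    have e1 : ∀ i ∈ T, ((q : ℝ) ^ d i - 1)⁻¹ * ((k : ℝ) * if k ≠ 0 ∧ d i ∣ k then 1 else 0) =
        ∑ m ∈ k.divisors, if d i = m then ((q : ℝ) ^ m - 1)⁻¹ * k else 0 := by
      intro i _
      rw [Finset.sum_ite_eq]
      simp only [Nat.mem_divisors]
      by_cases h : d i ∣ k <;> simp [h, h0.ne']
    rw [Finset.sum_congr rfl e1, Finset.sum_comm, ← Nat.sum_div_divisors k (fun i => (i : ℝ))]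
    apply Finset.sum_le_sum
    intro m hm
    have hmk := Nat.dvd_of_mem_divisors hm
    have hm1 : 1 ≤ m := Nat.pos_of_mem_divisors hm
    rw [← Finset.sum_filter, Finset.sum_const, nsmul_eq_mul]
    have hpos : (0 : ℝ) < (q : ℝ) ^ m - 1 := by
      linarith [one_lt_pow₀ hq2 (by omega : m ≠ 0)]
    have hm0 : (0 : ℝ) < m := by exact_mod_cast hm1
    rw [Nat.cast_div hmk hm0.ne', le_div_iff₀ hm0]
    have := hT m hm1
    calc _ = ((m : ℝ) * (T.filter fun i => d i = m).card) * (((q : ℝ) ^ m - 1)⁻¹ * k) := by ring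
      _ ≤ ((q : ℝ) ^ m - 1) * (((q : ℝ) ^ m - 1)⁻¹ * k) :=
        mul_le_mul_of_nonneg_right this (by positivity)
      _ = k := by rw [← mul_assoc, mul_inv_cancel₀ hpos.ne', one_mul]
  induction n using Nat.strong_induction_on with
  | _ n ih =>
    rcases Nat.eq_zero_or_pos n with h0 | h0
    · subst h0
      have : numPartitions 0 = 1 := by unfold numPartitions; simp
      rw [this, hW, PowerSeries.coeff_zero_eq_constantCoeff_apply, map_prod]
      apply le_of_eq
      rw [Nat.cast_one]
      apply Finset.prod_eq_one
      intro i _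
      have : PowerSeries.constantCoeff (sepRp (d i)) = 0 := by
        rw [← PowerSeries.coeff_zero_eq_constantCoeff_apply, sepRp, PowerSeries.coeff_mk]; simp
      simp [this]
    · have h1 := (le_abs_self _).trans (hmaj n)
      rw [coeff_sepTheta, PowerSeries.coeff_mul] at h1
      have hn : (0 : ℝ) < n := by exact_mod_cast h0
      refine le_of_mul_le_mul_left (h1.trans ?_) hn
      rw [sep_euler]
      apply Finset.sum_le_sum
      rintro ⟨a, b⟩ hx
      rw [Finset.HasAntidiagonal.mem_antidiagonal] at hx
      simp only at hx ⊢
      rcases Nat.eq_zero_or_pos a with ha | ha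
      · subst ha
        have := hS 0
        simp only [Nat.divisors_zero, Finset.sum_empty] at this ⊢
        rw [zero_mul]
        exact mul_nonpos_of_nonpos_of_nonneg this (hWnn _)
      · exact mul_le_mul (hS a) (ih b (by omega)) (hWnn _)
          (Finset.sum_nonneg fun i _ => by positivity)

open Polynomial in
theorem sepMonic_finite (F : Type) [Field F] [Fintype F] (n : ℕ) :
    {f : Polynomial F | f.Monic ∧ f.natDegree = n}.Finite := by
  have e := (monicEquivDegreeLT (R := F) n).trans (degreeLTEquiv F n).toEquiv
  have : Finite ↑{f : Polynomial F | f.Monic ∧ f.natDegree = n} := Finite.of_equiv _ e.symm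
  exact Set.toFinite _

/-- monic polynomials of degree `n` -/
noncomputable def sepMonic (F : Type) [Field F] [Fintype F] (n : ℕ) : Finset (Polynomial F) :=
  (sepMonic_finite F n).toFinset

theorem mem_sepMonic {F : Type} [Field F] [Fintype F] {n : ℕ} {f : Polynomial F} :
    f ∈ sepMonic F n ↔ f.Monic ∧ f.natDegree = n := by
  simp [sepMonic]

open Polynomial in
theorem card_sepMonic (F : Type) [Field F] [Fintype F] (n : ℕ) :
    (sepMonic F n).card = Fintype.card F ^ n := by
  have e := (monicEquivDegreeLT (R := F) n).trans (degreeLTEquiv F n).toEquiv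
  rw [sepMonic, ← Set.ncard_eq_toFinset_card _ (sepMonic_finite F n), ← Nat.card_coe_set_eq]
  rw [Nat.card_congr (show ↑{f : Polynomial F | f.Monic ∧ f.natDegree = n} ≃ (Fin n → F) from e)]
  simp

open Classical in
/-- monic irreducible polynomials of degree at most `D` -/
noncomputable def sepIrr (F : Type) [Field F] [Fintype F] (D : ℕ) : Finset (Polynomial F) :=
  ((Finset.range (D + 1)).biUnion (sepMonic F)).filter Irreducible

theorem mem_sepIrr {F : Type} [Field F] [Fintype F] {D : ℕ} {f : Polynomial F} :
    f ∈ sepIrr F D ↔ f.Monic ∧ Irreducible f ∧ f.natDegree ≤ D := by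
  simp [sepIrr, mem_sepMonic]
  tauto

/-- all monic irreducible factors lie in `S` -/
def sepSmooth {F : Type} [Field F] (S : Finset (Polynomial F)) (f : Polynomial F) : Prop :=
  ∀ p : Polynomial F, p.Monic → Irreducible p → p ∣ f → p ∈ S

theorem sepSmooth_insert_of_not_dvd {F : Type} [Field F] [DecidableEq (Polynomial F)]
    {S : Finset (Polynomial F)} {f p : Polynomial F} (h : ¬ p ∣ f) :
    sepSmooth (insert p S) f ↔ sepSmooth S f := by
  constructor
  · intro hs r hr hi hd
    have := hs r hr hi hd
    rw [Finset.mem_insert] at this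
    rcases this with rfl | h'
    · exact absurd hd h
    · exact h'
  · intro hs r hr hi hd
    exact Finset.mem_insert_of_mem (hs r hr hi hd)

theorem sep_dvd_monic {F : Type} [Field F] {p r : Polynomial F} (hp : p.Monic) (hr : r.Monic)
    (hpi : Irreducible p) (hri : Irreducible r) (h : r ∣ p) : r = p := by
  exact Polynomial.eq_of_monic_of_associated hr hp (hri.associated_of_dvd hpi h)

theorem sepSmooth_mul {F : Type} [Field F] [DecidableEq (Polynomial F)]
    {S : Finset (Polynomial F)} {g p : Polynomial F} (hp : p.Monic) (hpi : Irreducible p)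
    (hS : p ∈ S) : sepSmooth S (p * g) ↔ sepSmooth S g := by
  constructor
  · intro hs r hr hi hd
    exact hs r hr hi (dvd_mul_of_dvd_right hd p)
  · intro hs r hr hi hd
    rcases hi.prime.dvd_or_dvd hd with h | h
    · rwa [sep_dvd_monic hp hr hpi hi h]
    · exact hs r hr hi h

theorem sepSmooth_empty {F : Type} [Field F] {f : Polynomial F} (hf : f.Monic) :
    sepSmooth ∅ f ↔ f = 1 := by
  constructor
  · intro h
    by_contra h1
    have hu : ¬ IsUnit f := fun hu => h1 (hf.eq_one_of_isUnit hu)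
    obtain ⟨g, hg, hgi, hgf⟩ := Polynomial.exists_monic_irreducible_factor f hu
    exact absurd (h g hg hgi hgf) (by simp)
  · rintro rfl p _ hi hd
    exact absurd (isUnit_of_dvd_one hd) hi.not_isUnit

open Classical in
/-- generating function of monic polynomials satisfying a predicate, with weights -/
noncomputable def sepGen {F : Type} [Field F] [Fintype F] (Q : Polynomial F → Prop)
    (w : Polynomial F → ℝ) : PowerSeries ℝ :=
  PowerSeries.mk fun n => ∑ f ∈ (sepMonic F n).filter Q, w f

/-- splitting lemma -/
theorem sepGen_split {F : Type} [Field F] [Fintype F] (Q Q0 Q1 : Polynomial F → Prop)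
    (w : Polynomial F → ℝ) (p : Polynomial F) (hp : p.Monic) (c : ℝ)
    (h0 : ∀ f : Polynomial F, f.Monic → (Q0 f ↔ Q f ∧ ¬ p ∣ f))
    (h1 : ∀ g : Polynomial F, g.Monic → (Q1 g ↔ Q (p * g)))
    (hw : ∀ g : Polynomial F, g.Monic → Q (p * g) → w (p * g) = c * w g) :
    sepGen Q w = sepGen Q0 w + PowerSeries.C c * PowerSeries.X ^ p.natDegree * sepGen Q1 w := by
  classical
  ext n
  rw [map_add, mul_assoc, PowerSeries.coeff_C_mul, PowerSeries.coeff_X_pow_mul']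
  simp only [sepGen, PowerSeries.coeff_mk]
  rw [← Finset.sum_filter_not_add_sum_filter _ (fun f => p ∣ f)]
  congr 1
  · rw [Finset.filter_filter]
    apply Finset.sum_congr _ (fun _ _ => rfl)
    apply Finset.filter_congr
    intro f hf
    exact (h0 f (mem_sepMonic.mp hf).1).symm
  · split_ifs with hn
    · rw [Finset.mul_sum]
      symm
      apply Finset.sum_bij (fun g _ => p * g)
      · intro g hg
        simp only [Finset.mem_filter, mem_sepMonic] at hg ⊢
        obtain ⟨⟨hg1, hg2⟩, hg3⟩ := hg
        refine ⟨⟨⟨hp.mul hg1, ?_⟩, (h1 g hg1).mp hg3⟩, dvd_mul_right _ _⟩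
        rw [hp.natDegree_mul hg1]; omega
      · intro a _ b _ hab
        exact mul_left_cancel₀ hp.ne_zero hab
      · intro f hf
        simp only [Finset.mem_filter, mem_sepMonic] at hf
        obtain ⟨⟨⟨hf1, hf2⟩, hf3⟩, g, rfl⟩ := hf
        have hg : g.Monic := hp.of_mul_monic_left hf1
        refine ⟨g, ?_, rfl⟩
        simp only [Finset.mem_filter, mem_sepMonic]
        rw [hp.natDegree_mul hg] at hf2
        exact ⟨⟨hg, by omega⟩, (h1 g hg).mpr hf3⟩
      · intro g hg
        simp only [Finset.mem_filter, mem_sepMonic] at hg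
        exact (hw g hg.1.1 ((h1 g hg.1.1).mp hg.2)).symm
    · rw [mul_zero]
      apply Finset.sum_eq_zero
      intro f hf
      exfalso
      simp only [Finset.mem_filter, mem_sepMonic] at hf
      obtain ⟨⟨⟨hf1, hf2⟩, hf3⟩, hd⟩ := hf
      have := Polynomial.natDegree_le_of_dvd hd hf1.ne_zero
      omega

theorem sepGen_one {F : Type} [Field F] [Fintype F] (Q : Polynomial F → Prop)
    (w : Polynomial F → ℝ) (hw : w 1 = 1) (hQ : ∀ f : Polynomial F, f.Monic → (Q f ↔ f = 1)) :
    sepGen Q w = 1 := by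
  classical
  ext n
  rw [PowerSeries.coeff_one]
  simp only [sepGen, PowerSeries.coeff_mk]
  rw [Finset.filter_congr (q := fun f => f = 1) (fun f hf => hQ f (mem_sepMonic.mp hf).1),
    Finset.filter_eq']
  split_ifs with h1 h2 h2
  · simp [hw]
  · rw [mem_sepMonic] at h1; simp at h1; omega
  · rw [mem_sepMonic] at h1; simp at h1; omega
  · simp

theorem sepGen_all {F : Type} [Field F] [Fintype F] (S : Finset (Polynomial F))
    (hS : ∀ p ∈ S, p.Monic ∧ Irreducible p) :
    (∏ p ∈ S, (1 - (PowerSeries.X : PowerSeries ℝ) ^ p.natDegree)) *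
      sepGen (sepSmooth S) (fun _ => 1) = 1 := by
  classical
  induction S using Finset.induction_on with
  | empty => rw [Finset.prod_empty, one_mul]; exact sepGen_one _ _ rfl fun f hf => sepSmooth_empty hf
  | insert p S hp ih =>
    obtain ⟨hpm, hpi⟩ := hS p (by simp)
    have := sepGen_split (sepSmooth (insert p S)) (sepSmooth S) (sepSmooth (insert p S)) (fun _ => 1)
      p hpm 1 ?_ ?_ ?_
    · have ih' := ih fun r hr => hS r (by simp [hr])
      rw [Finset.prod_insert hp]
      rw [map_one, one_mul] at this
      rw [← sub_eq_iff_eq_add] at this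
      rw [← this] at ih'
      linear_combination ih'
    · intro f hf
      constructor
      · intro h
        have hd : ¬ p ∣ f := fun hd => hp (h p hpm hpi hd)
        exact ⟨(sepSmooth_insert_of_not_dvd hd).mpr h, hd⟩
      · rintro ⟨h, hd⟩
        exact (sepSmooth_insert_of_not_dvd hd).mp h
    · intro g hg
      exact (sepSmooth_mul hpm hpi (by simp)).symm
    · intros; ring

theorem sepGen_sqfree {F : Type} [Field F] [Fintype F] (S : Finset (Polynomial F))
    (hS : ∀ p ∈ S, p.Monic ∧ Irreducible p) (w : Polynomial F → ℝ) (hw1 : w 1 = 1)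
    (hw : ∀ p g : Polynomial F, p.Monic → Irreducible p → g.Monic → ¬ p ∣ g →
      w (p * g) = w p * w g) :
    sepGen (fun f => Squarefree f ∧ sepSmooth S f) w =
    (∏ p ∈ S, (1 + PowerSeries.C (w p) * (PowerSeries.X : PowerSeries ℝ) ^ p.natDegree)) := by
  classical
  induction S using Finset.induction_on with
  | empty =>
    rw [Finset.prod_empty]
    refine sepGen_one _ _ hw1 fun f hf => ?_
    rw [sepSmooth_empty hf]
    constructor
    · exact fun h => h.2
    · rintro rfl; exact ⟨squarefree_one, rfl⟩
  | insert p S hp ih =>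
    obtain ⟨hpm, hpi⟩ := hS p (by simp)
    have hsq : ∀ g, Squarefree (p * g) → ¬ p ∣ g := by
      intro g h hd
      have := h p (mul_dvd_mul_left p hd)
      exact hpi.not_isUnit this
    have := sepGen_split (fun f => Squarefree f ∧ sepSmooth (insert p S) f)
      (fun f => Squarefree f ∧ sepSmooth S f) (fun f => Squarefree f ∧ sepSmooth S f) w
      p hpm (w p) ?_ ?_ ?_
    · rw [this, Finset.prod_insert hp, ← ih fun r hr => hS r (by simp [hr])]
      ring
    · intro f hf
      constructor
      · rintro ⟨h', h⟩
        have hd : ¬ p ∣ f := fun hd => hp (h p hpm hpi hd)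
        exact ⟨⟨h', (sepSmooth_insert_of_not_dvd hd).mpr h⟩, hd⟩
      · rintro ⟨⟨h', h⟩, hd⟩
        exact ⟨h', (sepSmooth_insert_of_not_dvd hd).mp h⟩
    · intro g hg
      rw [sepSmooth_mul hpm hpi (by simp)]
      constructor
      · rintro ⟨h, h'⟩
        have hd : ¬ p ∣ g := fun hd => hp (h' p hpm hpi hd)
        refine ⟨?_, (sepSmooth_insert_of_not_dvd hd).mpr h'⟩
        rw [squarefree_mul_iff]
        exact ⟨(hpi.coprime_iff_not_dvd.mpr hd).isRelPrime, hpi.squarefree, h⟩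
      · rintro ⟨h, h'⟩
        exact ⟨h.of_mul_right, (sepSmooth_insert_of_not_dvd (hsq g h)).mp h'⟩
    · intro g hg h
      exact hw p g hpm hpi hg (hsq g h.1)

theorem sepSmooth_sepIrr {F : Type} [Field F] [Fintype F] {D : ℕ} {f : Polynomial F}
    (hf : f.Monic) (h : f.natDegree ≤ D) : sepSmooth (sepIrr F D) f := by
  intro p hp hi hd
  exact mem_sepIrr.mpr ⟨hp, hi, (Polynomial.natDegree_le_of_dvd hd hf.ne_zero).trans h⟩


open Polynomial in
theorem sep_adjoinRoot_card {F : Type} [Field F] [Fintype F] {f : F[X]} (hf : f.Monic) :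
    Nat.card (AdjoinRoot f) = Fintype.card F ^ f.natDegree := by
  have : Module.Finite F (AdjoinRoot f) := hf.finite_adjoinRoot
  rw [Module.natCard_eq_pow_finrank (K := F), (AdjoinRoot.powerBasis' hf).finrank,
    AdjoinRoot.powerBasis'_dim, Nat.card_eq_fintype_card]

open Polynomial in
theorem sep_irr_dvd {F : Type} [Field F] [Fintype F] {f : F[X]} (hf : f.Monic)
    (hi : Irreducible f) : f ∣ X ^ (Fintype.card F ^ f.natDegree) - X := by
  have : Fact (Irreducible f) := ⟨hi⟩
  have hfin : Module.Finite F (AdjoinRoot f) := hf.finite_adjoinRoot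
  have : Finite (AdjoinRoot f) := Module.finite_of_finite F
  have : Fintype (AdjoinRoot f) := Fintype.ofFinite _
  rw [← AdjoinRoot.mk_eq_zero, map_sub, map_pow, AdjoinRoot.mk_X, ← sep_adjoinRoot_card hf,
    Nat.card_eq_fintype_card, FiniteField.pow_card, sub_self]

open Polynomial Classical in
theorem sep_irr_count {F : Type} [Field F] [Fintype F] (q : ℕ) (hq : Fintype.card F = q) (D m : ℕ)
    (hm : 1 ≤ m) :
    (m : ℝ) * (((sepIrr F D).erase X).filter fun f => f.natDegree = m).card ≤ (q : ℝ) ^ m - 1 := by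
  set T := ((sepIrr F D).erase X).filter fun f => f.natDegree = m with hT
  have hq2 : 1 < q := hq ▸ Fintype.one_lt_card
  have hXT : X ∉ T := by simp [hT]
  have hmem : ∀ f ∈ insert X T, f.Monic ∧ Irreducible f := by
    intro f hf
    rw [Finset.mem_insert] at hf
    rcases hf with rfl | hf
    · exact ⟨monic_X, irreducible_X⟩
    · rw [hT, Finset.mem_filter, Finset.mem_erase, mem_sepIrr] at hf
      exact ⟨hf.1.2.1, hf.1.2.2.1⟩
  have hd : ∏ f ∈ insert X T, f ∣ X ^ (Fintype.card F ^ m) - X := by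
    apply Finset.prod_dvd_of_coprime
    · intro a ha b hb hab
      have h1 := hmem a ha
      have h2 := hmem b hb
      refine (h1.2.coprime_iff_not_dvd).mpr fun h => hab ?_
      exact sep_dvd_monic h2.1 h1.1 h2.2 h1.2 h
    · intro f hf
      rw [Finset.mem_insert] at hf
      rcases hf with rfl | hf
      · apply dvd_sub_self_right.mpr
        exact dvd_pow_self X (by have : 0 < Fintype.card F := Fintype.card_pos
                                 positivity)
      · have h1 := hmem f (by simp [hf])
        rw [hT, Finset.mem_filter] at hf
        rw [← hf.2]
        exact sep_irr_dvd h1.1 h1.2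
  have hle := natDegree_le_of_dvd hd (by
    rw [hq]; exact FiniteField.X_pow_card_pow_sub_X_ne_zero F (by omega) hq2)
  rw [hq, FiniteField.X_pow_card_pow_sub_X_natDegree_eq F (by omega) hq2, Finset.prod_insert hXT,
    natDegree_mul X_ne_zero, natDegree_X, natDegree_prod_of_monic, Finset.sum_congr rfl
      (g := fun _ => m)] at hle
  · rw [Finset.sum_const, smul_eq_mul] at hle
    have : ((1 + T.card * m : ℕ) : ℝ) ≤ ((q ^ m : ℕ) : ℝ) := by exact_mod_cast hle
    push_cast at this
    linarith
  · intro f hf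
    rw [hT, Finset.mem_filter] at hf
    exact hf.2
  · intro f hf
    exact (hmem f (by simp [hf])).1
  · exact (monic_prod_of_monic _ _ fun f hf => (hmem f (by simp [hf])).1).ne_zero

open Polynomial in
/-- number of units modulo `f` -/
noncomputable def sepPhi {F : Type} [Field F] (f : F[X]) : ℕ := Nat.card (AdjoinRoot f)ˣ

open Polynomial in
theorem sepPhi_one {F : Type} [Field F] : sepPhi (1 : F[X]) = 1 := by
  unfold sepPhi
  have : Subsingleton (AdjoinRoot (1 : F[X])) := by
    apply Ideal.Quotient.subsingleton_iff.mpr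
    simp
  exact Nat.card_of_subsingleton 1

open Polynomial in
theorem sepPhi_mul {F : Type} [Field F] (f g : F[X]) (h : IsCoprime f g) :
    sepPhi (f * g) = sepPhi f * sepPhi g := by
  unfold sepPhi
  have hc : IsCoprime (Ideal.span {f}) (Ideal.span {g}) := by
    rwa [Ideal.isCoprime_span_singleton_iff]
  have e1 : AdjoinRoot (f * g) ≃+* (F[X] ⧸ (Ideal.span {f} * Ideal.span {g})) :=
    Ideal.quotEquivOfEq (by rw [Ideal.span_singleton_mul_span_singleton])
  have e2 : AdjoinRoot (f * g) ≃+* AdjoinRoot f × AdjoinRoot g :=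
    e1.trans (Ideal.quotientMulEquivQuotientProd _ _ hc)
  rw [Nat.card_congr ((Units.mapEquiv e2.toMulEquiv).trans MulEquiv.prodUnits).toEquiv,
    Nat.card_prod]

open Polynomial in
theorem sepPhi_irr {F : Type} [Field F] [Fintype F] {f : F[X]} (hf : f.Monic)
    (hi : Irreducible f) : (sepPhi f : ℝ) = (Fintype.card F : ℝ) ^ f.natDegree - 1 := by
  have : Fact (Irreducible f) := ⟨hi⟩
  have hfin : Module.Finite F (AdjoinRoot f) := hf.finite_adjoinRoot
  have : Finite (AdjoinRoot f) := Module.finite_of_finite F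
  have h := Nat.card_units (AdjoinRoot f)
  rw [sep_adjoinRoot_card hf] at h
  unfold sepPhi
  rw [h, Nat.cast_sub]
  · push_cast; ring
  · exact Nat.one_le_pow _ _ Fintype.card_pos

open Polynomial in
theorem sep_singular {F : Type} [Field F] {n : ℕ} (A : Matrix (Fin n) (Fin n) F) (p : F[X])
    (hp : Irreducible p) (hd : p ∣ A.charpoly) :
    ∃ v : Fin n → F, v ≠ 0 ∧ aeval A.toLin' p v = 0 := by
  have : Fact (Irreducible p) := ⟨hp⟩
  let K := AdjoinRoot p
  let i : F →+* K := AdjoinRoot.of p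
  let B : Matrix (Fin n) (Fin n) K := A.map i
  have hroot : (B.toLin').charpoly.IsRoot (AdjoinRoot.root p) := by
    rw [Matrix.charpoly_toLin', Matrix.charpoly_map]
    obtain ⟨c, hc⟩ := hd
    rw [hc, Polynomial.map_mul, IsRoot, eval_mul, eval_map, AdjoinRoot.eval₂_root, zero_mul]
  rw [← Module.End.hasEigenvalue_iff_isRoot_charpoly] at hroot
  obtain ⟨w, hw⟩ := hroot.exists_hasEigenvector
  have h1 := Module.End.aeval_apply_of_hasEigenvector (p := p.map i) hw
  rw [eval_map, AdjoinRoot.eval₂_root, zero_smul] at h1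
  have h2 : aeval B.toLin' (p.map i) = ((aeval A p).map i).toLin' := by
    have h3 : aeval B (p.map i) = (aeval A p).map i := by
      have : (aeval A p).map i = i.mapMatrix (aeval A p) := rfl
      rw [this, aeval_def, aeval_def, hom_eval₂, eval₂_map]
      congr 1
      ext x
      simp [Matrix.algebraMap_matrix_apply]
      split_ifs <;> simp
    rw [← h3]
    exact (aeval_algHom_apply (Matrix.toLinAlgEquiv' (R := K) (n := Fin n)).toAlgHom B _)
  rw [h2, Matrix.toLin'_apply] at h1
  have h4 : ((aeval A p).map i).det = 0 :=
    Matrix.exists_mulVec_eq_zero_iff.mp ⟨w, hw.2, h1⟩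
  have h5 : (aeval A p).det = 0 := by
    have : i ((aeval A p).det) = 0 := by rw [RingHom.map_det]; exact h4
    exact (map_eq_zero i).mp this
  obtain ⟨v, hv, hv2⟩ := Matrix.exists_mulVec_eq_zero_iff.mpr h5
  refine ⟨v, hv, ?_⟩
  have : aeval A.toLin' p = (aeval A p).toLin' :=
    aeval_algHom_apply (Matrix.toLinAlgEquiv' (R := F) (n := Fin n)).toAlgHom A p
  rw [this, Matrix.toLin'_apply, hv2]

open Polynomial Classical in
theorem sep_sqfree_prod {F : Type} [Field F] (f : F[X]) (hf : f.Monic) (hs : Squarefree f) :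
    ∃ S : Finset F[X], (∀ p ∈ S, p.Monic ∧ Irreducible p) ∧ f = ∏ p ∈ S, p := by
  refine ⟨(UniqueFactorizationMonoid.normalizedFactors f).toFinset, ?_, ?_⟩
  · intro p hp
    rw [Multiset.mem_toFinset] at hp
    have h0 := UniqueFactorizationMonoid.irreducible_of_normalized_factor p hp
    refine ⟨?_, h0⟩
    have := UniqueFactorizationMonoid.normalize_normalized_factor p hp
    rw [← this]
    exact monic_normalize h0.ne_zero
  · have h1 := (UniqueFactorizationMonoid.squarefree_iff_nodup_normalizedFactors hf.ne_zero).mp hs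
    have h2 := UniqueFactorizationMonoid.prod_normalizedFactors_eq hf.ne_zero
    rw [hf.normalize_eq_self] at h2
    conv_lhs => rw [← h2]
    rw [Finset.prod_multiset_count]
    apply Finset.prod_congr rfl
    intro p hp
    rw [Multiset.count_eq_one_of_mem h1 (Multiset.mem_toFinset.mp hp), pow_one]

open Polynomial Classical in
theorem sep_cyclic {F : Type} [Field F] {n : ℕ} (A : Matrix (Fin n) (Fin n) F)
    (hs : Squarefree A.charpoly) :
    ∃ v : Fin n → F, ∀ g : F[X], aeval A.toLin' g v = 0 → A.charpoly ∣ g := by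
  obtain ⟨S, hS, hprod⟩ := sep_sqfree_prod A.charpoly A.charpoly_monic hs
  have hex : ∀ p : F[X], ∃ v : Fin n → F, p ∈ S → v ≠ 0 ∧ aeval A.toLin' p v = 0 := by
    intro p
    by_cases hp : p ∈ S
    · obtain ⟨v, hv⟩ := sep_singular A p (hS p hp).2 (hprod ▸ Finset.dvd_prod_of_mem _ hp)
      exact ⟨v, fun _ => hv⟩
    · exact ⟨0, fun h => absurd h hp⟩
  choose v hv using hex
  refine ⟨∑ p ∈ S, v p, fun g hg => ?_⟩
  have hcop : ∀ p ∈ S, ∀ r ∈ S, p ≠ r → IsCoprime p r := by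
    intro a ha b hb hab
    refine ((hS a ha).2.coprime_iff_not_dvd).mpr fun h => hab ?_
    exact sep_dvd_monic (hS b hb).1 (hS a ha).1 (hS b hb).2 (hS a ha).2 h
  rw [hprod]
  apply Finset.prod_dvd_of_coprime
  · intro a ha b hb hab
    exact hcop a ha b hb hab
  · intro p hp
    by_contra hpg
    set c := ∏ r ∈ S.erase p, r with hc
    have h1 : aeval A.toLin' (c * g) (∑ r ∈ S, v r) = 0 := by
      rw [map_mul, Module.End.mul_apply, hg, map_zero]
    have h2 : aeval A.toLin' (c * g) (∑ r ∈ S, v r) = aeval A.toLin' (c * g) (v p) := by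
      rw [map_sum]
      apply Finset.sum_eq_single_of_mem p hp
      intro r hr hrp
      obtain ⟨k, hk⟩ : r ∣ c * g :=
        (Finset.dvd_prod_of_mem _ (Finset.mem_erase.mpr ⟨hrp, hr⟩)).mul_right g
      rw [hk, mul_comm, map_mul, Module.End.mul_apply, (hv r hr).2, map_zero]
    rw [h2] at h1
    have h3 : IsCoprime (c * g) p := by
      apply IsCoprime.mul_left
      · apply IsCoprime.prod_left
        intro r hr
        rw [Finset.mem_erase] at hr
        exact hcop r hr.2 p hp hr.1
      · exact ((hS p hp).2.coprime_iff_not_dvd.mpr hpg).symm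
    obtain ⟨a, b, hab⟩ := h3
    apply (hv p hp).1
    have h4 : aeval A.toLin' (a * (c * g) + b * p) (v p) = 0 := by
      rw [map_add, LinearMap.add_apply, map_mul _ a, map_mul _ b, Module.End.mul_apply,
        Module.End.mul_apply, h1, (hv p hp).2]
      simp
    rw [hab] at h4
    simpa using h4

open Polynomial in
theorem sep_finrank {F : Type} [Field F] (f : F[X]) (hf : f.Monic) :
    Module.finrank F (AdjoinRoot f) = f.natDegree := by
  rw [(AdjoinRoot.powerBasis' hf).finrank, AdjoinRoot.powerBasis'_dim]

open Polynomial in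
theorem sep_equiv {F : Type} [Field F] {n : ℕ} (f : F[X]) (hs : Squarefree f)
    (A : Matrix (Fin n) (Fin n) F) (hA : A.charpoly = f) :
    ∃ e : AdjoinRoot f ≃ₗ[F] (Fin n → F), ∀ x, e (AdjoinRoot.root f * x) = A.toLin' (e x) := by
  have hf : f.Monic := hA ▸ A.charpoly_monic
  have hdeg : f.natDegree = n := by rw [← hA, A.charpoly_natDegree_eq_dim, Fintype.card_fin]
  obtain ⟨v, hv⟩ := sep_cyclic A (hA ▸ hs)
  rw [hA] at hv
  have hCH : aeval A.toLin' f = 0 := by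
    have := LinearMap.aeval_self_charpoly A.toLin'
    rwa [Matrix.charpoly_toLin', hA] at this
  let T : AdjoinRoot f →ₗ[F] (Fin n → F) :=
    ((LinearMap.applyₗ v : Module.End F (Fin n → F) →ₗ[F] (Fin n → F)).comp
      (aeval A.toLin' : F[X] →ₐ[F] Module.End F (Fin n → F)).toLinearMap).comp
      (AdjoinRoot.modByMonicHom hf)
  have hT : ∀ g : F[X], T (AdjoinRoot.mk f g) = aeval A.toLin' g v := by
    intro g
    have h1 : T (AdjoinRoot.mk f g) = aeval A.toLin' (g %ₘ f) v := by
      simp [T, AdjoinRoot.modByMonicHom_mk]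
    rw [h1]
    conv_rhs => rw [← modByMonic_add_div g f, map_add, map_mul, hCH, zero_mul, add_zero]
  have hinj : Function.Injective T := by
    rw [← LinearMap.ker_eq_bot, LinearMap.ker_eq_bot']
    intro x hx
    induction x using AdjoinRoot.induction_on with
    | _ g =>
      rw [hT] at hx
      exact AdjoinRoot.mk_eq_zero.mpr (hv g hx)
  refine ⟨LinearEquiv.ofInjectiveOfFinrankEq T hinj ?_, ?_⟩
  · rw [sep_finrank f hf, hdeg]; simp
  · intro x
    change T _ = A.toLin' (T x)
    induction x using AdjoinRoot.induction_on with
    | _ g =>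
      rw [← AdjoinRoot.mk_X, ← map_mul, hT, hT, map_mul, aeval_X, Module.End.mul_apply]

open Polynomial in
theorem sep_charpoly_root {F : Type} [Field F] {n : ℕ} (f : F[X]) (hf : f.Monic)
    (e : AdjoinRoot f ≃ₗ[F] (Fin n → F)) (A : Matrix (Fin n) (Fin n) F)
    (h : ∀ x, e (AdjoinRoot.root f * x) = A.toLin' (e x)) : A.charpoly = f := by
  have : Module.Finite F (AdjoinRoot f) := (AdjoinRoot.powerBasis' hf).finite
  have h1 : e.conj (Algebra.lmul F (AdjoinRoot f) (AdjoinRoot.root f)) = A.toLin' := by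
    ext1 y
    ext1
    simp only [LinearMap.comp_apply, LinearEquiv.conj_apply_apply]
    have := h (e.symm (LinearMap.single F (fun _ => F) y 1))
    rw [e.apply_symm_apply] at this
    exact this
  rw [← Matrix.charpoly_toLin', ← h1, LinearEquiv.charpoly_conj,
    ← LinearMap.charpoly_toMatrix _ (AdjoinRoot.powerBasis hf.ne_zero).basis,
    ← Algebra.leftMulMatrix_apply]
  have h2 := charpoly_leftMulMatrix (AdjoinRoot.powerBasis hf.ne_zero)
  rw [AdjoinRoot.minpoly_powerBasis_gen_of_monic hf] at h2
  exact h2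

open Polynomial in
theorem sep_count {F : Type} [Field F] [Fintype F] {n : ℕ} (f : F[X]) (hf : f.Monic)
    (hs : Squarefree f) (hn : f.natDegree = n) :
    Nat.card {A : Matrix (Fin n) (Fin n) F // A.charpoly = f} * sepPhi f =
      Nat.card (Matrix.GeneralLinearGroup (Fin n) F) := by
  have : Module.Finite F (AdjoinRoot f) := (AdjoinRoot.powerBasis' hf).finite
  have e0 : AdjoinRoot f ≃ₗ[F] (Fin n → F) :=
    LinearEquiv.ofFinrankEq _ _ (by rw [sep_finrank f hf, hn]; simp)
  have hE : Nat.card (AdjoinRoot f ≃ₗ[F] (Fin n → F)) =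
      Nat.card (Matrix.GeneralLinearGroup (Fin n) F) := by
    apply Nat.card_congr
    refine Equiv.trans ?_ (Matrix.GeneralLinearGroup.toLin.toEquiv.trans
      (LinearMap.GeneralLinearGroup.generalLinearEquiv F (Fin n → F)).toEquiv).symm
    exact ⟨fun e => e0.symm.trans e, fun g => e0.trans g, fun e => by ext x; simp,
      fun g => by ext x; simp⟩
  rw [← hE, sepPhi, ← Nat.card_prod]
  choose e he using fun A : {A : Matrix (Fin n) (Fin n) F // A.charpoly = f} =>
    sep_equiv f hs A.1 A.2
  let mu : (AdjoinRoot f)ˣ → (AdjoinRoot f ≃ₗ[F] AdjoinRoot f) := fun u =>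
    { toFun := fun x => u * x
      invFun := fun x => (u⁻¹ : (AdjoinRoot f)ˣ) * x
      map_add' := fun x y => mul_add _ _ _
      map_smul' := fun c x => by simp
      left_inv := fun x => by simp
      right_inv := fun x => by simp }
  have hmu : ∀ u x, mu u x = u * x := fun _ _ => rfl
  have hcomm : ∀ A u x, ((mu u).trans (e A)) (AdjoinRoot.root f * x) =
      A.1.toLin' (((mu u).trans (e A)) x) := by
    intro A u x
    simp only [LinearEquiv.trans_apply, hmu]
    rw [mul_left_comm, he]
  apply Nat.card_eq_of_bijective (fun Au : _ × (AdjoinRoot f)ˣ => (mu Au.2).trans (e Au.1))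
  constructor
  · rintro ⟨A, u⟩ ⟨B, w⟩ hAB
    simp only at hAB
    have hAeq : A = B := by
      apply Subtype.ext
      apply Matrix.toLin'.injective
      apply LinearMap.ext
      intro y
      obtain ⟨x, rfl⟩ := ((mu u).trans (e A)).surjective y
      rw [← hcomm, hAB, ← hcomm]
    subst hAeq
    have := congrArg (fun g => g 1) hAB
    simp only [LinearEquiv.trans_apply, hmu, mul_one] at this
    have := (e A).injective this
    rw [Units.ext this]
  · intro g
    let A0 : Matrix (Fin n) (Fin n) F := LinearMap.toMatrix'
      (g.conj (Algebra.lmul F (AdjoinRoot f) (AdjoinRoot.root f)))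
    have hA0 : ∀ x, g (AdjoinRoot.root f * x) = A0.toLin' (g x) := by
      intro x
      simp only [A0, Matrix.toLin'_toMatrix', LinearEquiv.conj_apply_apply,
        LinearEquiv.symm_apply_apply]
      rfl
    let A : {A : Matrix (Fin n) (Fin n) F // A.charpoly = f} :=
      ⟨A0, sep_charpoly_root f hf g A0 hA0⟩
    let h := g.trans (e A).symm
    have hroot : ∀ x, h (AdjoinRoot.root f * x) = AdjoinRoot.root f * h x := by
      intro x
      apply (e A).injective
      simp only [h, LinearEquiv.trans_apply, he, LinearEquiv.apply_symm_apply, hA0]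
      rfl
    have hlin : ∀ x y, h (x * y) = x * h y := by
      intro x
      induction x using AdjoinRoot.induction_on with
      | _ p =>
        induction p using Polynomial.induction_on' with
        | add p r hp hr => intro y; rw [map_add, add_mul, map_add, hp, hr, add_mul]
        | monomial k a =>
          induction k with
          | zero =>
            intro y
            have : (AdjoinRoot.mk f) (monomial 0 a) = algebraMap F (AdjoinRoot f) a := rfl
            rw [this, ← Algebra.smul_def, map_smul, Algebra.smul_def]
          | succ k ih =>
            intro y
            rw [← monomial_mul_X, map_mul (AdjoinRoot.mk f), AdjoinRoot.mk_X, mul_assoc, ih, hroot, mul_assoc]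
    have hun : IsUnit (h 1) := by
      obtain ⟨z, hz⟩ := h.surjective 1
      refine IsUnit.of_mul_eq_one z ?_
      rw [mul_comm, ← hlin, mul_one, hz]
    obtain ⟨u, hu⟩ := hun
    refine ⟨(A, u), ?_⟩
    ext1 x
    simp only [LinearEquiv.trans_apply, hmu]
    rw [hu, mul_comm, ← hlin, mul_one]
    simp [h]

open Polynomial Classical in
theorem sep_an {F : Type} [Field F] [Fintype F] (n : ℕ) :
    separableProportion F n * (Fintype.card F : ℝ) ^ (n ^ 2) /
        ∏ i ∈ Finset.range n, ((Fintype.card F : ℝ) ^ n - (Fintype.card F : ℝ) ^ i) =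
      ∑ f ∈ (sepMonic F n).filter Squarefree, ((sepPhi f : ℝ))⁻¹ := by
  have hq0 : (0:ℝ) < Fintype.card F := by exact_mod_cast Fintype.card_pos
  have hGL : ((Nat.card (Matrix.GeneralLinearGroup (Fin n) F) : ℕ) : ℝ) =
      ∏ i ∈ Finset.range n, ((Fintype.card F : ℝ) ^ n - (Fintype.card F : ℝ) ^ i) := by
    rw [Matrix.card_GL_field, Nat.cast_prod, Finset.prod_range]
    apply Finset.prod_congr rfl
    intro i _
    rw [Nat.cast_sub (Nat.pow_le_pow_right Fintype.card_pos i.2.le)]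
    push_cast; rfl
  have hGL0 : ((Nat.card (Matrix.GeneralLinearGroup (Fin n) F) : ℕ) : ℝ) ≠ 0 := by
    exact_mod_cast Nat.card_pos.ne'
  rw [separableProportion, div_mul_cancel₀ _ (by positivity), ← hGL, div_eq_iff hGL0,
    Finset.sum_mul]
  have hpart : Nat.card {A : Matrix (Fin n) (Fin n) F // Squarefree A.charpoly} =
      ∑ f ∈ (sepMonic F n).filter Squarefree,
        Nat.card {A : Matrix (Fin n) (Fin n) F // A.charpoly = f} := by
    rw [Nat.card_eq_fintype_card, Fintype.card_subtype]
    rw [Finset.card_eq_sum_card_fiberwise (f := fun A => A.charpoly)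
      (t := (sepMonic F n).filter Squarefree)]
    · apply Finset.sum_congr rfl
      intro f hf
      rw [Nat.card_eq_fintype_card, Fintype.card_subtype, Finset.filter_filter]
      congr 1
      ext A
      simp only [Finset.mem_filter, Finset.mem_univ, true_and]
      constructor
      · exact fun h => h.2
      · intro h
        exact ⟨h ▸ (Finset.mem_filter.mp hf).2, h⟩
    · intro A hA
      simp only [Finset.coe_filter, Finset.mem_univ, true_and, Set.mem_ofPred_eq] at hA ⊢
      refine ⟨?_, hA⟩
      rw [mem_sepMonic]
      exact ⟨A.charpoly_monic, by rw [A.charpoly_natDegree_eq_dim, Fintype.card_fin]⟩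
  rw [hpart, Nat.cast_sum]
  apply Finset.sum_congr rfl
  intro f hf
  rw [Finset.mem_filter, mem_sepMonic] at hf
  have := sep_count f hf.1.1 hf.2 hf.1.2
  rw [← this, Nat.cast_mul]
  have h0 : (sepPhi f : ℝ) ≠ 0 := by
    intro h
    rw [← this, Nat.cast_mul, h, mul_zero] at hGL0
    exact hGL0 rfl
  field_simp

/-- `X^d / (1 + X^d)`. -/
noncomputable def sepRm (d : ℕ) : PowerSeries ℝ :=
  PowerSeries.mk fun k => if k ≠ 0 ∧ d ∣ k then -(-1) ^ (k / d) else 0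

theorem sepRm_mul (d : ℕ) (hd : 1 ≤ d) :
    (1 + (PowerSeries.X : PowerSeries ℝ) ^ d) * sepRm d = PowerSeries.X ^ d := by
  ext n
  rw [add_mul, one_mul, map_add, PowerSeries.coeff_X_pow_mul', PowerSeries.coeff_X_pow]
  simp only [sepRm, PowerSeries.coeff_mk]
  by_cases h : n = d
  · subst h
    have : n ≠ 0 := by omega
    simp [Nat.div_self hd, this]
  · by_cases h2 : d ≤ n
    · have h1 : n - d ≠ 0 := by omega
      have h3 : d ∣ n - d ↔ d ∣ n := by
        rw [← Nat.dvd_sub_iff_left h2 (dvd_refl d)]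
      have h4 : n ≠ 0 := by omega
      by_cases h5 : d ∣ n
      · have h6 : n / d = (n - d) / d + 1 := by
          rw [← Nat.add_div_right _ (by omega), Nat.sub_add_cancel h2]
        simp [h, h2, h1, h3, h4, h5, h6, pow_succ]
      · simp [h, h2, h3, h5]
    · have : ¬ (n ≠ 0 ∧ d ∣ n) := fun ⟨h5, h6⟩ => h2 (Nat.le_of_dvd (by omega) h6)
      rw [if_neg this]; simp [h, h2]

theorem sepRm_maj (e : ℝ) (he : 0 ≤ e) (d : ℕ) :
    sepMaj (1 + PowerSeries.C e * sepRm d) (1 + PowerSeries.C e * sepRp d) := by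
  apply sepMaj_one.add
  intro n
  rw [PowerSeries.coeff_C_mul, PowerSeries.coeff_C_mul, abs_mul, abs_of_nonneg he]
  apply mul_le_mul_of_nonneg_left _ he
  simp only [sepRm, sepRp, PowerSeries.coeff_mk]
  split_ifs
  · rw [abs_neg, abs_pow]; simp
  · simp

theorem sep_factor (d : ℕ) (hd : 1 ≤ d) (e : ℝ) :
    (1 + PowerSeries.C (1 + e) * (PowerSeries.X : PowerSeries ℝ) ^ d) * (1 - PowerSeries.X ^ d) =
      (1 - (PowerSeries.X ^ 2) ^ d) * (1 + PowerSeries.C e * sepRm d) := by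
  have h := sepRm_mul d hd
  rw [map_add, map_one]
  linear_combination (-(1 - (PowerSeries.X : PowerSeries ℝ) ^ d) * PowerSeries.C e) * h

theorem sep_head (q : ℝ) (hq : 2 ≤ q) :
    sepMaj ((1 - PowerSeries.C q * PowerSeries.X ^ 2) * (1 + PowerSeries.C ((q - 1)⁻¹) * sepRm 1))
      (PowerSeries.mk (fun _ => 1) + PowerSeries.C q * PowerSeries.X ^ 2) := by
  intro n
  have h1 : 0 < q - 1 := by linarith
  have h2 : (q - 1)⁻¹ ≤ 1 := inv_le_one_of_one_le₀ (by linarith)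
  have h3 : 0 < (q - 1)⁻¹ := inv_pos.mpr h1
  have h4 : (q - 1) * (q - 1)⁻¹ = 1 := mul_inv_cancel₀ h1.ne'
  rw [sub_mul, one_mul, mul_assoc, map_sub, PowerSeries.coeff_C_mul, PowerSeries.coeff_X_pow_mul',
    map_add, map_add, map_add, PowerSeries.coeff_C_mul, PowerSeries.coeff_C_mul,
    PowerSeries.coeff_C_mul, PowerSeries.coeff_one, PowerSeries.coeff_one, PowerSeries.coeff_X_pow]
  simp only [sepRm, PowerSeries.coeff_mk]
  match n with
  | 0 => simp
  | 1 => simp; rw [abs_of_pos h1]; exact h2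
  | 2 =>
    simp
    rw [abs_le]; constructor <;> linarith
  | n + 3 =>
    have h5 : n + 3 - 2 = n + 1 := by omega
    have h6 : n + 3 ≠ 2 := by omega
    simp only [h5, h6]
    simp
    have : (-((q - 1)⁻¹ * (-1) ^ (n + 3)) + q * ((q - 1)⁻¹ * (-1) ^ (n + 1))) = (-1) ^ (n + 1) := by
      have : ((-1 : ℝ)) ^ (n + 3) = (-1) ^ (n + 1) := by rw [pow_succ, pow_succ]; ring
      rw [this]
      linear_combination ((-1) ^ (n + 1)) * h4
    rw [this, abs_pow]; simp

section
variable (F : Type) [Field F] [Fintype F]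

/-- `∏ (1 - X^{deg p})` over monic irreducibles of degree at most `D`. -/
noncomputable def sepB (D : ℕ) : PowerSeries ℝ :=
  ∏ p ∈ sepIrr F D, (1 - (PowerSeries.X : PowerSeries ℝ) ^ p.natDegree)

theorem sepIrr_pos {D : ℕ} {p : Polynomial F} (hp : p ∈ sepIrr F D) : 1 ≤ p.natDegree :=
  (mem_sepIrr.mp hp).2.1.natDegree_pos

theorem sepB_coeff (D n : ℕ) (h : n ≤ D) : PowerSeries.coeff n (sepB F D) =
    PowerSeries.coeff n (1 - PowerSeries.C (Fintype.card F : ℝ) * PowerSeries.X) := by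
  classical
  set G := sepGen (sepSmooth (sepIrr F D)) (fun _ => 1) with hG
  have h1 : sepB F D * G = 1 := sepGen_all _ fun p hp => ⟨(mem_sepIrr.mp hp).1, (mem_sepIrr.mp hp).2.1⟩
  set H : PowerSeries ℝ := PowerSeries.mk fun n => (Fintype.card F : ℝ) ^ n with hH
  have h2 : (1 - PowerSeries.C (Fintype.card F : ℝ) * PowerSeries.X) * H = 1 := by
    ext m
    rw [sub_mul, one_mul, map_sub, mul_assoc, PowerSeries.coeff_C_mul, PowerSeries.coeff_one]
    cases m with
    | zero => simp [hH]
    | succ m => rw [PowerSeries.coeff_succ_X_mul]; simp [hH, pow_succ]; ring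
  have h3 : (PowerSeries.X : PowerSeries ℝ) ^ (D + 1) ∣ H - G := by
    rw [PowerSeries.X_pow_dvd_iff]
    intro m hm
    rw [map_sub, sub_eq_zero]
    simp only [hH, hG, sepGen, PowerSeries.coeff_mk]
    rw [Finset.filter_true_of_mem]
    · rw [Finset.sum_const, card_sepMonic]; simp
    · intro f hf
      rw [mem_sepMonic] at hf
      exact sepSmooth_sepIrr hf.1 (by omega)
  have h4 : (PowerSeries.X : PowerSeries ℝ) ^ (D + 1) ∣
      sepB F D - (1 - PowerSeries.C (Fintype.card F : ℝ) * PowerSeries.X) := by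
    have : sepB F D - (1 - PowerSeries.C (Fintype.card F : ℝ) * PowerSeries.X) =
      sepB F D * (1 - PowerSeries.C (Fintype.card F : ℝ) * PowerSeries.X) * (H - G) := by
      linear_combination (-sepB F D) * h2 +
        (1 - PowerSeries.C (Fintype.card F : ℝ) * PowerSeries.X) * h1
    rw [this]
    exact h3.mul_left _
  rw [PowerSeries.X_pow_dvd_iff] at h4
  have := h4 n (by omega)
  rwa [map_sub, sub_eq_zero] at this

theorem sepB_abs (D n : ℕ) :
    |PowerSeries.coeff n (sepB F D)| ≤ (Fintype.card F : ℝ) ^ n := by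
  classical
  have h1 : sepMaj (sepB F D) (∏ p ∈ sepIrr F D,
      (1 + PowerSeries.C ((fun _ => 1 : Polynomial F → ℝ) p) * (PowerSeries.X : PowerSeries ℝ) ^ p.natDegree)) := by
    apply sepMaj.prod
    intro p _
    rw [sub_eq_add_neg]
    apply sepMaj_one.add
    intro n
    simp only [map_neg, map_one, one_mul, PowerSeries.coeff_X_pow]
    split_ifs <;> simp
  rw [← sepGen_sqfree _ (fun p hp => ⟨(mem_sepIrr.mp hp).1, (mem_sepIrr.mp hp).2.1⟩) (fun _ => 1)
    rfl (by simp)] at h1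
  refine (h1 n).trans ?_
  simp only [sepGen, PowerSeries.coeff_mk]
  rw [Finset.sum_const, nsmul_eq_mul, mul_one, ← Nat.cast_pow, ← card_sepMonic, Nat.cast_le]
  apply Finset.card_le_card
  intro f hf
  simp only [Finset.mem_filter] at hf
  exact hf.1

/-- `∏ (1 - X^{2 deg p})` -/
noncomputable def sepBB (D : ℕ) : PowerSeries ℝ :=
  ∏ p ∈ sepIrr F D, (1 - ((PowerSeries.X : PowerSeries ℝ) ^ 2) ^ p.natDegree)

theorem sepBB_eq (D : ℕ) : sepBB F D = PowerSeries.expand 2 two_ne_zero (sepB F D) := by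
  rw [sepBB, sepB, map_prod]
  apply Finset.prod_congr rfl
  intro p _
  rw [map_sub, map_one, map_pow, PowerSeries.expand_X]

theorem sepBB_coeff (D n : ℕ) (h : n ≤ D) : PowerSeries.coeff n (sepBB F D) =
    PowerSeries.coeff n (1 - PowerSeries.C (Fintype.card F : ℝ) * PowerSeries.X ^ 2) := by
  have : (1 - PowerSeries.C (Fintype.card F : ℝ) * PowerSeries.X ^ 2) =
      PowerSeries.expand 2 two_ne_zero (1 - PowerSeries.C (Fintype.card F : ℝ) * PowerSeries.X) := by
    rw [map_sub, map_one, map_mul, PowerSeries.expand_X, PowerSeries.expand_C]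
  rw [this, sepBB_eq, PowerSeries.coeff_expand, PowerSeries.coeff_expand]
  split_ifs
  · apply sepB_coeff
    omega
  · rfl

theorem sepBB_maj (D : ℕ) :
    sepMaj (sepBB F D) (PowerSeries.mk fun m => Real.sqrt (Fintype.card F) ^ m) := by
  intro n
  rw [sepBB_eq, PowerSeries.coeff_expand, PowerSeries.coeff_mk]
  split_ifs with h
  · obtain ⟨m, rfl⟩ := h
    rw [Nat.mul_div_cancel_left _ two_pos, pow_mul, Real.sq_sqrt (Nat.cast_nonneg _)]
    exact sepB_abs F D m
  · simp

/-- the main product -/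
noncomputable def sepA (D : ℕ) : PowerSeries ℝ :=
  ∏ p ∈ sepIrr F D, (1 + PowerSeries.C (1 + ((Fintype.card F : ℝ) ^ p.natDegree - 1)⁻¹) *
    (PowerSeries.X : PowerSeries ℝ) ^ p.natDegree)

/-- the correction product -/
noncomputable def sepE (D : ℕ) : PowerSeries ℝ :=
  ∏ p ∈ sepIrr F D, (1 + PowerSeries.C (((Fintype.card F : ℝ) ^ p.natDegree - 1)⁻¹) *
    sepRm p.natDegree)

theorem sep_AB (D : ℕ) : sepA F D * sepB F D = sepBB F D * sepE F D := by
  rw [sepA, sepB, sepBB, sepE, ← Finset.prod_mul_distrib, ← Finset.prod_mul_distrib]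
  apply Finset.prod_congr rfl
  intro p hp
  exact sep_factor _ (sepIrr_pos F hp) _

theorem sep_card_two : (2 : ℝ) ≤ Fintype.card F := by
  have : 1 < Fintype.card F := Fintype.one_lt_card
  exact_mod_cast this

theorem sep_pow_sub_pos (d : ℕ) (hd : 1 ≤ d) : 0 < (Fintype.card F : ℝ) ^ d - 1 := by
  have := one_lt_pow₀ (lt_of_lt_of_le one_lt_two (sep_card_two F)) (n := d) (by omega)
  linarith

theorem sepE_split (D : ℕ) (hD : 1 ≤ D) : ∃ W : PowerSeries ℝ,
    sepE F D = (1 + PowerSeries.C (((Fintype.card F : ℝ) - 1)⁻¹) * sepRm 1) * W ∧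
    sepMaj W sepP := by
  classical
  have hX : (Polynomial.X : Polynomial F) ∈ sepIrr F D := by
    rw [mem_sepIrr]
    exact ⟨Polynomial.monic_X, Polynomial.irreducible_X, by simpa using hD⟩
  refine ⟨∏ p ∈ (sepIrr F D).erase Polynomial.X,
    (1 + PowerSeries.C (((Fintype.card F : ℝ) ^ p.natDegree - 1)⁻¹) * sepRm p.natDegree), ?_, ?_⟩
  · rw [sepE, ← Finset.mul_prod_erase _ _ hX]
    simp
  · have h1 : sepMaj (∏ p ∈ (sepIrr F D).erase Polynomial.X,
      (1 + PowerSeries.C (((Fintype.card F : ℝ) ^ p.natDegree - 1)⁻¹) * sepRm p.natDegree))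
      (∏ p ∈ (sepIrr F D).erase Polynomial.X,
      (1 + PowerSeries.C (((Fintype.card F : ℝ) ^ p.natDegree - 1)⁻¹) * sepRp p.natDegree)) := by
      apply sepMaj.prod
      intro p hp
      apply sepRm_maj
      exact (inv_pos.mpr (sep_pow_sub_pos F _ (sepIrr_pos F (Finset.mem_of_mem_erase hp)))).le
    intro n
    refine (h1 n).trans ?_
    rw [sepP, PowerSeries.coeff_mk]
    apply sep_W_le
    · exact Fintype.one_lt_card
    · intro m hm
      convert sep_irr_count (F := F) (Fintype.card F) rfl D m hm

theorem sep_mk_one_mul (A : PowerSeries ℝ) (n : ℕ) :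
    PowerSeries.coeff n (PowerSeries.mk (fun _ => 1) * A) =
      ∑ i ∈ Finset.range (n + 1), PowerSeries.coeff i A := by
  rw [mul_comm, PowerSeries.coeff_mul, Finset.Nat.sum_antidiagonal_eq_sum_range_succ_mk]
  simp

theorem sep_coeff_eq (A B C : PowerSeries ℝ) (D : ℕ)
    (h : ∀ n ≤ D, PowerSeries.coeff n A = PowerSeries.coeff n B) :
    ∀ n ≤ D, PowerSeries.coeff n (A * C) = PowerSeries.coeff n (B * C) := by
  intro n hn
  rw [PowerSeries.coeff_mul, PowerSeries.coeff_mul]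
  apply Finset.sum_congr rfl
  intro x hx
  rw [Finset.HasAntidiagonal.mem_antidiagonal] at hx
  rw [h x.1 (by omega)]

theorem sep_AB_bound (D k : ℕ) (hk : 2 ≤ k) (hkD : k ≤ D) :
    |PowerSeries.coeff k (sepA F D * sepB F D)| ≤
      (numPartitionsCumulative k : ℝ) + (Fintype.card F : ℝ) * numPartitions (k - 2) := by
  obtain ⟨W, hE, hW⟩ := sepE_split F D (by omega)
  rw [sep_AB, sep_coeff_eq _ _ _ D (sepBB_coeff F D) k hkD, hE, ← mul_assoc]
  refine ((sep_head _ (sep_card_two F)).mul hW k).trans ?_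
  rw [add_mul, map_add, sep_mk_one_mul, mul_assoc, PowerSeries.coeff_C_mul,
    PowerSeries.coeff_X_pow_mul', if_pos hk, numPartitionsCumulative]
  simp [sepP]

theorem sep_AB_dom (D : ℕ) (hD : 1 ≤ D) :
    sepMaj (sepA F D * sepB F D)
      ((PowerSeries.mk fun m => Real.sqrt (Fintype.card F) ^ m) *
        PowerSeries.mk fun n => (numPartitionsCumulative n : ℝ)) := by
  obtain ⟨W, hE, hW⟩ := sepE_split F D hD
  rw [sep_AB, hE]
  apply (sepBB_maj F D).mul
  have h2 := sep_card_two F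
  have h : sepMaj (1 + PowerSeries.C (((Fintype.card F : ℝ) - 1)⁻¹) * sepRm 1)
      (PowerSeries.mk (fun _ => 1)) := by
    intro n
    refine (sepRm_maj _ (by rw [inv_nonneg]; linarith) 1 n).trans ?_
    rw [map_add, PowerSeries.coeff_C_mul, PowerSeries.coeff_one]
    simp only [sepRp, PowerSeries.coeff_mk]
    by_cases hn : n = 0
    · simp [hn]
    · simp [hn]
      exact inv_le_one_of_one_le₀ (by linarith)
  intro n
  refine (h.mul hW n).trans ?_
  rw [sep_mk_one_mul, PowerSeries.coeff_mk, numPartitionsCumulative]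
  simp [sepP]
end

section
variable (F : Type) [Field F] [Fintype F]

open Classical in
/-- the normalised count of separable matrices -/
noncomputable def sepa (n : ℕ) : ℝ :=
  ∑ f ∈ (sepMonic F n).filter Squarefree, ((sepPhi f : ℝ))⁻¹

theorem sepA_coeff (D n : ℕ) (h : n ≤ D) :
    PowerSeries.coeff n (sepA F D) = sepa F n * (Fintype.card F : ℝ) ^ n := by
  classical
  let w : Polynomial F → ℝ := fun f => (Fintype.card F : ℝ) ^ f.natDegree * ((sepPhi f : ℝ))⁻¹
  have h1 : sepA F D = ∏ p ∈ sepIrr F D,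
      (1 + PowerSeries.C (w p) * (PowerSeries.X : PowerSeries ℝ) ^ p.natDegree) := by
    apply Finset.prod_congr rfl
    intro p hp
    have h0 := sep_pow_sub_pos F _ (sepIrr_pos F hp)
    rw [mem_sepIrr] at hp
    have : 1 + ((Fintype.card F : ℝ) ^ p.natDegree - 1)⁻¹ = w p := by
      simp only [w]
      rw [sepPhi_irr hp.1 hp.2.1]
      field_simp
      ring
    rw [this]
  rw [h1, ← sepGen_sqfree _ (fun p hp => ⟨(mem_sepIrr.mp hp).1, (mem_sepIrr.mp hp).2.1⟩) w]
  · simp only [sepGen, PowerSeries.coeff_mk, sepa]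
    rw [Finset.sum_mul]
    apply Finset.sum_congr
    · ext f
      simp only [Finset.mem_filter]
      constructor
      · exact fun h => ⟨h.1, h.2.1⟩
      · intro hf
        have := mem_sepMonic.mp hf.1
        exact ⟨hf.1, hf.2, sepSmooth_sepIrr this.1 (by omega)⟩
    · intro f hf
      simp only [Finset.mem_filter, mem_sepMonic] at hf
      simp only [w]
      rw [hf.1.2, mul_comm]
  · simp [w, sepPhi_one]
  · intro p g hp hpi hg hpg
    have hc : IsCoprime p g := hpi.coprime_iff_not_dvd.mpr hpg
    simp only [w]
    rw [sepPhi_mul p g hc, hp.natDegree_mul hg, pow_add, Nat.cast_mul, mul_inv]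
    ring

theorem sepa_zero : sepa F 0 = 1 := by
  have := sepA_coeff F 0 0 le_rfl
  rw [pow_zero, mul_one] at this
  rw [← this]
  have h : sepIrr F 0 = ∅ := by
    rw [Finset.eq_empty_iff_forall_notMem]
    intro p hp
    have h1 := sepIrr_pos F hp
    have h2 := (mem_sepIrr.mp hp).2.2
    omega
  rw [sepA, h]; simp

/-- increments -/
noncomputable def sepg (k : ℕ) : ℝ := if k = 0 then 1 else sepa F k - sepa F (k - 1)

theorem sepg_sum (n : ℕ) : ∑ k ∈ Finset.range (n + 1), sepg F k = sepa F n := by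
  induction n with
  | zero => simp [sepg, sepa_zero]
  | succ n ih => rw [Finset.sum_range_succ, ih]; simp [sepg]

theorem sepg_eq (D k : ℕ) (h : k ≤ D) :
    PowerSeries.coeff k (sepA F D * sepB F D) * ((Fintype.card F : ℝ))⁻¹ ^ k = sepg F k := by
  have hq := sep_card_two F
  have hq0 : (Fintype.card F : ℝ) ≠ 0 := by linarith
  rw [mul_comm (sepA F D), sep_coeff_eq _ _ _ D (sepB_coeff F D) k h, sub_mul, one_mul, map_sub,
    mul_assoc, PowerSeries.coeff_C_mul, sepA_coeff F D k h, sepg]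
  cases k with
  | zero => simp [sepa_zero]
  | succ k =>
    rw [PowerSeries.coeff_succ_X_mul, sepA_coeff F D k (by omega), if_neg (by omega),
      Nat.add_sub_cancel, inv_pow]
    field_simp
    ring

open Polynomial in
theorem sep_tsum_one (D : ℕ) :
    ∑' k, PowerSeries.coeff k (sepA F D * sepB F D) * ((Fintype.card F : ℝ))⁻¹ ^ k = 1 := by
  let P : ℝ[X] := ∏ p ∈ sepIrr F D,
    ((1 + C (1 + ((Fintype.card F : ℝ) ^ p.natDegree - 1)⁻¹) * X ^ p.natDegree) *
      (1 - X ^ p.natDegree))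
  have hP : sepA F D * sepB F D = (P : PowerSeries ℝ) := by
    rw [sepA, sepB, ← Finset.prod_mul_distrib]
    have := map_prod (Polynomial.coeToPowerSeries.ringHom (R := ℝ)) (fun p : F[X] =>
      ((1 + C (1 + ((Fintype.card F : ℝ) ^ p.natDegree - 1)⁻¹) * X ^ p.natDegree) *
      (1 - X ^ p.natDegree) : ℝ[X])) (sepIrr F D)
    simp only [Polynomial.coeToPowerSeries.ringHom_apply] at this
    rw [this]
    apply Finset.prod_congr rfl
    intro p _
    simp
  have hev : P.eval ((Fintype.card F : ℝ))⁻¹ = 1 := by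
    rw [eval_prod]
    apply Finset.prod_eq_one
    intro p hp
    have h0 := sep_pow_sub_pos F _ (sepIrr_pos F hp)
    have hq := sep_card_two F
    have hq0 : (Fintype.card F : ℝ) ^ p.natDegree ≠ 0 := pow_ne_zero _ (by linarith)
    simp only [eval_mul, eval_add, eval_sub, eval_one, eval_C, eval_pow, eval_X, inv_pow]
    field_simp
    ring
  rw [hP, ← hev, eval_eq_sum_range]
  rw [tsum_eq_sum (s := Finset.range (P.natDegree + 1))]
  · simp [Polynomial.coeff_coe]
  · intro k hk
    rw [Finset.mem_range, not_lt] at hk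
    rw [Polynomial.coeff_coe, coeff_eq_zero_of_natDegree_lt (by omega), zero_mul]

theorem sep_p2_summable : Summable fun n : ℕ =>
    (numPartitionsCumulative n : ℝ) * ((Fintype.card F : ℝ))⁻¹ ^ n := by
  have hq := sep_card_two F
  have h1 : Summable fun n : ℕ => 3 * (3 / 2 * ((Fintype.card F : ℝ))⁻¹) ^ n := by
    apply Summable.mul_left
    apply summable_geometric_of_lt_one (by positivity)
    rw [← div_eq_mul_inv, div_lt_one (by linarith)]
    linarith
  refine Summable.of_nonneg_of_le (fun n => by positivity) (fun n => ?_) h1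
  rw [mul_pow, ← mul_assoc]
  exact mul_le_mul_of_nonneg_right (sep_p2_le n) (by positivity)

theorem sep_bound_summable : Summable fun k : ℕ =>
    PowerSeries.coeff k ((PowerSeries.mk fun m => Real.sqrt (Fintype.card F) ^ m) *
        PowerSeries.mk fun n => (numPartitionsCumulative n : ℝ)) * ((Fintype.card F : ℝ))⁻¹ ^ k := by
  have hq := sep_card_two F
  have h1 : Summable fun n : ℕ => ‖Real.sqrt (Fintype.card F) ^ n * ((Fintype.card F : ℝ))⁻¹ ^ n‖ := by
    simp only [← mul_pow, norm_pow]
    apply summable_geometric_of_lt_one (norm_nonneg _)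
    rw [Real.norm_of_nonneg (by positivity), ← div_eq_mul_inv, div_lt_one (by linarith)]
    rw [Real.sqrt_lt' (by linarith)]
    nlinarith
  have h2 := (sep_p2_summable F).norm
  have h3 := (summable_norm_sum_mul_antidiagonal_of_summable_norm h1 h2).of_norm
  refine h3.congr fun k => ?_
  rw [PowerSeries.coeff_mul, Finset.sum_mul]
  apply Finset.sum_congr rfl
  intro x hx
  rw [Finset.HasAntidiagonal.mem_antidiagonal] at hx
  rw [PowerSeries.coeff_mk, PowerSeries.coeff_mk, ← hx, pow_add]
  ring

theorem sepg_summable : Summable (sepg F) := by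
  refine Summable.of_norm_bounded (sep_bound_summable F) fun k => ?_
  rw [← sepg_eq F (k + 1) k (by omega), norm_mul, norm_pow, norm_inv, Real.norm_natCast]
  exact mul_le_mul_of_nonneg_right (sep_AB_dom F (k + 1) (by omega) k) (by positivity)

open Filter Topology in
theorem sepg_tsum : ∑' k, sepg F k = 1 := by
  have h := tendsto_tsum_of_dominated_convergence (𝓕 := atTop)
    (f := fun D k => PowerSeries.coeff k (sepA F D * sepB F D) * ((Fintype.card F : ℝ))⁻¹ ^ k)
    (g := sepg F) (sep_bound_summable F) ?_ ?_
  · simp only [sep_tsum_one] at h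
    exact tendsto_nhds_unique h tendsto_const_nhds
  · intro k
    apply tendsto_const_nhds.congr'
    filter_upwards [eventually_ge_atTop k] with D hD
    exact (sepg_eq F D k hD).symm
  · filter_upwards [eventually_ge_atTop 1] with D hD
    intro k
    rw [norm_mul, norm_pow, norm_inv, Real.norm_natCast]
    exact mul_le_mul_of_nonneg_right (sep_AB_dom F D hD k) (by positivity)

theorem sep_term_le (k : ℕ) (hk : 2 ≤ k) :
    ((numPartitionsCumulative k : ℝ) + Fintype.card F * (numPartitions (k - 2) : ℝ)) *
      ((Fintype.card F : ℝ))⁻¹ ^ k ≤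
    (3 + 4 * (Fintype.card F : ℝ) / 9) * (3 / (2 * (Fintype.card F : ℝ))) ^ k := by
  have h1 := sep_p2_le k
  have h2 := sep_p_le (k - 2)
  have h3 : ((3 : ℝ) / 2) ^ k = (3 / 2) ^ (k - 2) * (9 / 4) := by
    conv_lhs => rw [← Nat.sub_add_cancel hk, pow_add]
    norm_num
  have h4 : (3 / (2 * (Fintype.card F : ℝ))) ^ k = (3 / 2) ^ k * ((Fintype.card F : ℝ))⁻¹ ^ k := by
    rw [← mul_pow]
    congr 1
    rw [← div_eq_mul_inv, div_div]
  rw [h4, ← mul_assoc]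
  apply mul_le_mul_of_nonneg_right _ (by positivity)
  have h5 : (Fintype.card F : ℝ) * (numPartitions (k - 2) : ℝ) ≤
      Fintype.card F * (3 / 2) ^ (k - 2) := mul_le_mul_of_nonneg_left h2 (by positivity)
  rw [add_mul]
  apply add_le_add h1
  rw [h3]
  refine h5.trans (le_of_eq ?_)
  ring

theorem sep_geom (n : ℕ) : HasSum (fun d : ℕ =>
    (3 + 4 * (Fintype.card F : ℝ) / 9) * (3 / (2 * (Fintype.card F : ℝ))) ^ (n + 1 + d))
    ((1 / 3) * ((4 * Fintype.card F + 27) / (2 * Fintype.card F - 3)) *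
      (3 / (2 * (Fintype.card F : ℝ))) ^ n) := by
  have hq := sep_card_two F
  have h1 : 3 / (2 * (Fintype.card F : ℝ)) < 1 := by rw [div_lt_one (by linarith)]; linarith
  have h2 := (hasSum_geometric_of_lt_one (by positivity) h1).mul_left
    ((3 + 4 * (Fintype.card F : ℝ) / 9) * (3 / (2 * (Fintype.card F : ℝ))) ^ (n + 1))
  have h6 : (1 / 3) * ((4 * (Fintype.card F : ℝ) + 27) / (2 * Fintype.card F - 3)) *
      (3 / (2 * (Fintype.card F : ℝ))) ^ n = (3 + 4 * (Fintype.card F : ℝ) / 9) *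
      (3 / (2 * (Fintype.card F : ℝ))) ^ (n + 1) * (1 - 3 / (2 * (Fintype.card F : ℝ)))⁻¹ := by
    have h3 : 2 * (Fintype.card F : ℝ) - 3 ≠ 0 := by linarith
    have h4 : (Fintype.card F : ℝ) ≠ 0 := by linarith
    have h5 : (1 - 3 / (2 * (Fintype.card F : ℝ))) =
        (2 * (Fintype.card F : ℝ) - 3) / (2 * Fintype.card F) := by
      field_simp
    rw [h5, inv_div, pow_succ]
    generalize (3 / (2 * (Fintype.card F : ℝ))) ^ n = y
    field_simp
    ring
  rw [h6]
  have h7 : (fun d : ℕ => (3 + 4 * (Fintype.card F : ℝ) / 9) *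
      (3 / (2 * (Fintype.card F : ℝ))) ^ (n + 1 + d)) = fun d : ℕ =>
      (3 + 4 * (Fintype.card F : ℝ) / 9) * (3 / (2 * (Fintype.card F : ℝ))) ^ (n + 1) *
      (3 / (2 * (Fintype.card F : ℝ))) ^ d := by
    funext d; rw [pow_add _ (n + 1) d]; ring
  rw [h7]
  exact h2
end

/-- For `n ≥ 1`:
`|s_M(n,q)·q^{n²}/|GL(n,q)| − 1| ≤ ∑_{d=n+1}^∞ (p₂(d) + q·p(d−2)) q^{−d}
  ≤ (1/3)·((4q+27)/(2q−3))·(2q/3)^{−n}`. -/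
theorem separable_convergence_rate {F : Type} [Field F] [Fintype F] (q : ℕ)
    (hq : Fintype.card F = q) (n : ℕ) (hn : 1 ≤ n) :
    |separableProportion F n * (q : ℝ) ^ (n ^ 2) /
        ∏ i ∈ Finset.range n, ((q : ℝ) ^ n - (q : ℝ) ^ i) - 1| ≤
      ∑' d : ℕ, ((numPartitionsCumulative (n + 1 + d) : ℝ) +
          q * (numPartitions (n + 1 + d - 2) : ℝ)) * ((q : ℝ))⁻¹ ^ (n + 1 + d) ∧
    ∑' d : ℕ, ((numPartitionsCumulative (n + 1 + d) : ℝ) +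
          q * (numPartitions (n + 1 + d - 2) : ℝ)) * ((q : ℝ))⁻¹ ^ (n + 1 + d) ≤
      (1 / 3) * ((4 * q + 27) / (2 * q - 3)) * (3 / (2 * (q : ℝ))) ^ n := by
  subst hq
  have hle : ∀ d : ℕ, ((numPartitionsCumulative (n + 1 + d) : ℝ) +
      Fintype.card F * (numPartitions (n + 1 + d - 2) : ℝ)) *
        ((Fintype.card F : ℝ))⁻¹ ^ (n + 1 + d) ≤ _ := fun d => sep_term_le F (n + 1 + d) (by omega)
  have hgeom := sep_geom F n
  have hsum := Summable.of_nonneg_of_le (fun d => by positivity) hle hgeom.summable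
  refine ⟨?_, hasSum_le hle hsum.hasSum hgeom⟩
  have h1 : separableProportion F n * (Fintype.card F : ℝ) ^ (n ^ 2) /
        ∏ i ∈ Finset.range n, ((Fintype.card F : ℝ) ^ n - (Fintype.card F : ℝ) ^ i) = sepa F n :=
    sep_an n
  have h2 := (sepg_summable F).sum_add_tsum_nat_add (n + 1)
  rw [sepg_sum, sepg_tsum] at h2
  have h3 : sepa F n - 1 = -∑' i, sepg F (i + (n + 1)) := by linarith
  rw [h1, h3, abs_neg, ← Real.norm_eq_abs]
  apply tsum_of_norm_bounded hsum.hasSum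
  intro d
  rw [← sepg_eq F (d + (n + 1)) _ le_rfl, norm_mul, norm_pow, norm_inv, Real.norm_natCast,
    add_comm d (n + 1)]
  exact mul_le_mul_of_nonneg_right (sep_AB_bound F _ _ (by omega) le_rfl) (by positivity)
end

section
/- Let F_q be a finite field with q elements. Then for every n ≥ 0, the number of nilpotent n×n matrices over F_q equals q^{n(n−1)} (the Fine–Herstein theorem). -/
open Module

section FineHerstein

variable {F : Type} [Field F]

/-- The block upper triangular endomorphism with diagonal blocks `J`, `D` and corner `B`. -/
def blockEnd {W U : Type} [AddCommGroup W] [Module F W] [AddCommGroup U] [Module F U]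
    (J : End F W) (B : U →ₗ[F] W) (D : End F U) : End F (W × U) :=
  LinearMap.prod (J ∘ₗ LinearMap.fst F W U + B ∘ₗ LinearMap.snd F W U)
    (D ∘ₗ LinearMap.snd F W U)

lemma blockEnd_apply {W U : Type} [AddCommGroup W] [Module F W] [AddCommGroup U] [Module F U]
    (J : End F W) (B : U →ₗ[F] W) (D : End F U) (w : W) (u : U) :
    blockEnd J B D (w, u) = (J w + B u, D u) := rfl

lemma blockEnd_nilpotent_iff {W U : Type} [AddCommGroup W] [Module F W] [AddCommGroup U]
    [Module F U] (J : End F W) (hJ : IsNilpotent J) (B : U →ₗ[F] W) (D : End F U) :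
    IsNilpotent (blockEnd J B D) ↔ IsNilpotent D := by
  have hsnd : ∀ m x, ((blockEnd J B D ^ m) x).2 = (D ^ m) x.2 := by
    intro m
    induction m with
    | zero => intro x; rfl
    | succ m ih => intro x; rw [pow_succ, pow_succ, Module.End.mul_apply, ih]; rfl
  have hinl : ∀ m (w : W), (blockEnd J B D ^ m) (w, 0) = ((J ^ m) w, 0) := by
    intro m
    induction m with
    | zero => intro x; rfl
    | succ m ih =>
      intro x
      rw [pow_succ, pow_succ, Module.End.mul_apply, blockEnd_apply]
      simp only [map_zero, add_zero]
      rw [ih]; rfl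
  constructor
  · rintro ⟨m, hm⟩
    refine ⟨m, LinearMap.ext fun u => ?_⟩
    have := hsnd m (0, u)
    rw [hm] at this
    exact this.symm
  · rintro ⟨m, hm⟩
    obtain ⟨j, hj⟩ := hJ
    refine ⟨j + m, LinearMap.ext fun x => ?_⟩
    rw [pow_add, Module.End.mul_apply]
    have h2 : (blockEnd J B D ^ m) x = (((blockEnd J B D ^ m) x).1, 0) := by
      refine Prod.ext rfl ?_
      rw [hsnd, hm]; rfl
    rw [h2, hinl, hj]; rfl

lemma card_block {W U : Type} [AddCommGroup W] [Module F W] [AddCommGroup U] [Module F U]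
    (J : End F W) (hJ : IsNilpotent J) :
    Nat.card {N : End F (W × U) // IsNilpotent N ∧ ∀ w, N (w, 0) = (J w, 0)}
      = Nat.card (U →ₗ[F] W) * Nat.card {D : End F U // IsNilpotent D} := by
  rw [← Nat.card_prod]
  symm
  refine Nat.card_congr (Equiv.ofBijective (fun p => ⟨blockEnd J p.1 p.2.1,
    (blockEnd_nilpotent_iff J hJ _ _).2 p.2.2, fun w => by simp [blockEnd_apply]⟩) ⟨?_, ?_⟩)
  · rintro ⟨B, D, hD⟩ ⟨B', D', hD'⟩ h
    have h0 : blockEnd J B D = blockEnd J B' D' := congrArg Subtype.val h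
    have h1 : ∀ u, B u = B' u ∧ D u = D' u := by
      intro u
      have := LinearMap.congr_fun h0 (0, u)
      simpa [blockEnd_apply] using this
    have hB : B = B' := LinearMap.ext fun u => (h1 u).1
    have hDD : D = D' := LinearMap.ext fun u => (h1 u).2
    subst hB; subst hDD; rfl
  · rintro ⟨N, hN, hw⟩
    have key : blockEnd J (LinearMap.fst F W U ∘ₗ N ∘ₗ LinearMap.inr F W U)
        (LinearMap.snd F W U ∘ₗ N ∘ₗ LinearMap.inr F W U) = N := by
      refine LinearMap.ext fun ⟨w, u⟩ => ?_
      have : ((w, u) : W × U) = (w, 0) + (0, u) := by simp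
      rw [this, map_add N, hw, ← this, blockEnd_apply]
      ext <;> simp
    refine ⟨⟨LinearMap.fst F W U ∘ₗ N ∘ₗ LinearMap.inr F W U,
      LinearMap.snd F W U ∘ₗ N ∘ₗ LinearMap.inr F W U, ?_⟩, Subtype.ext key⟩
    rw [← key] at hN
    exact (blockEnd_nilpotent_iff J hJ _ _).1 hN

lemma card_block' {W U V : Type} [AddCommGroup W] [Module F W] [AddCommGroup U] [Module F U]
    [AddCommGroup V] [Module F V] (e : (W × U) ≃ₗ[F] V)
    (J : End F W) (hJ : IsNilpotent J) :
    Nat.card {N : End F V // IsNilpotent N ∧ ∀ w, N (e (w, 0)) = e (J w, 0)}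
      = Nat.card (U →ₗ[F] W) * Nat.card {D : End F U // IsNilpotent D} := by
  rw [← card_block J hJ]
  symm
  refine Nat.card_congr (Equiv.subtypeEquiv e.conjRingEquiv.toEquiv fun N => ?_)
  refine and_congr (IsNilpotent.map_iff (f := e.conjRingEquiv) e.conjRingEquiv.injective).symm
    (forall_congr' fun w => ?_)
  change _ ↔ e (N (e.symm (e (w, 0)))) = _
  simp

/-- The shift on the span of a linearly independent chain. -/
lemma exists_shift {W : Type} [AddCommGroup W] [Module F W] {k : ℕ} (b : Basis (Fin (k + 1)) F W) :
    ∃ J : End F W, IsNilpotent J ∧ (∀ i : Fin k, J (b i.castSucc) = b i.succ) ∧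
      J (b (Fin.last k)) = 0 := by
  let J : End F W := b.constr F (Fin.snoc (α := fun _ => W) (fun i : Fin k => b i.succ) 0)
  have h1 : ∀ i : Fin k, J (b i.castSucc) = b i.succ := fun i => by
    simp [J, Basis.constr_basis]
  have h2 : J (b (Fin.last k)) = 0 := by simp [J, Basis.constr_basis]
  refine ⟨J, ?_, h1, h2⟩
  have h3 : ∀ i : Fin (k + 1), (J ^ (k + 1 - (i : ℕ))) (b i) = 0 := by
    intro i
    induction i using Fin.reverseInduction with
    | last => simpa using h2
    | cast i ih =>
      have : k + 1 - (i.castSucc : ℕ) = (k + 1 - (i.succ : ℕ)) + 1 := by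
        simp; omega
      rw [this, pow_succ, Module.End.mul_apply, h1, ih]
  refine ⟨k + 1, b.ext fun i => ?_⟩
  have h4 : J ^ (k + 1) = J ^ (i : ℕ) * J ^ (k + 1 - (i : ℕ)) := by
    rw [← pow_add]; congr 1; omega
  rw [h4, Module.End.mul_apply, h3]
  simp

lemma pow_finrank_eq_zero {W : Type} [AddCommGroup W] [Module F W] [FiniteDimensional F W]
    (N : End F W) (hN : IsNilpotent N) : N ^ finrank F W = 0 := by
  have := N.aeval_self_charpoly
  rw [(LinearMap.isNilpotent_iff_charpoly N).1 hN] at this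
  simpa using this

lemma chain_end {V : Type} [AddCommGroup V] [Module F V]
    {k : ℕ} (v : Fin (k + 1) → V) (hv : LinearIndependent F v) (N : End F V)
    (hN : IsNilpotent N) (hc : ∀ i : Fin k, N (v i.castSucc) = v i.succ)
    (hl : N (v (Fin.last k)) ∈ Submodule.span F (Set.range v)) : N (v (Fin.last k)) = 0 := by
  have hW : ∀ x ∈ Submodule.span F (Set.range v), N x ∈ Submodule.span F (Set.range v) := by
    intro x hx
    induction hx using Submodule.span_induction with
    | mem x hx =>
      obtain ⟨i, rfl⟩ := hx
      induction i using Fin.lastCases with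
      | last => exact hl
      | cast i => rw [hc]; exact Submodule.subset_span ⟨_, rfl⟩
    | zero => simp
    | add x y _ _ hx hy => rw [map_add]; exact add_mem hx hy
    | smul a x _ hx => rw [map_smul]; exact Submodule.smul_mem _ _ hx
  have hp : ∀ i : Fin (k + 1), (N ^ (i : ℕ)) (v 0) = v i := by
    intro i
    induction i using Fin.induction with
    | zero => rfl
    | succ i ih =>
      rw [Fin.val_succ, pow_succ', Module.End.mul_apply]
      rw [Fin.val_castSucc] at ih
      rw [ih, hc]
  have hR : IsNilpotent (N.restrict hW) := by
    obtain ⟨m, hm⟩ := hN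
    refine ⟨m, ?_⟩
    rw [Module.End.pow_restrict]
    ext x
    simp [hm]
  have : FiniteDimensional F (Submodule.span F (Set.range v)) :=
    FiniteDimensional.span_of_finite F (Set.finite_range v)
  have h0 := pow_finrank_eq_zero _ hR
  rw [finrank_span_eq_card hv, Fintype.card_fin, Module.End.pow_restrict] at h0
  have h1 := congrArg Subtype.val
    (LinearMap.congr_fun h0 ⟨v 0, Submodule.subset_span ⟨0, rfl⟩⟩)
  have h2 : (N ^ (k + 1)) (v 0) = 0 := h1
  rw [pow_succ', Module.End.mul_apply] at h2
  have h3 := hp (Fin.last k)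
  rw [Fin.val_last] at h3
  rwa [h3] at h2

variable [Fintype F]

instance finite_end_aux {V W : Type} [AddCommGroup V] [Module F V] [FiniteDimensional F V]
    [AddCommGroup W] [Module F W] [FiniteDimensional F W] : Finite (V →ₗ[F] W) :=
  Module.finite_of_finite F

/-- Number of nilpotent endomorphisms with a prescribed full Jordan chain. -/
lemma card_closed {V : Type} [AddCommGroup V] [Module F V] [FiniteDimensional F V]
    {k d : ℕ} (v : Fin (k + 1) → V) (hv : LinearIndependent F v)
    (hd : finrank F V = d + (k + 1))
    (hnil : ∀ U : Submodule F V, finrank F U = d →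
      Nat.card {D : End F U // IsNilpotent D} = Nat.card F ^ (d * (d - 1))) :
    Nat.card {N : End F V // IsNilpotent N ∧ (∀ i : Fin k, N (v i.castSucc) = v i.succ) ∧
      N (v (Fin.last k)) = 0} = Nat.card F ^ (d * (d + k)) := by
  obtain ⟨U, hU⟩ := Submodule.exists_isCompl (Submodule.span F (Set.range v))
  have hWr : finrank F (Submodule.span F (Set.range v)) = k + 1 := by
    rw [finrank_span_eq_card hv, Fintype.card_fin]
  have hUr : finrank F U = d := by
    have := Submodule.finrank_add_eq_of_isCompl hU
    omega
  obtain ⟨J, hJ, hJ1, hJ2⟩ := exists_shift (Basis.span hv)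
  have h := card_block' (Submodule.prodEquivOfIsCompl _ _ hU) J hJ
  rw [hnil U hUr, Module.natCard_eq_pow_finrank (K := F)
    (V := U →ₗ[F] Submodule.span F (Set.range v)), Module.finrank_linearMap, hWr, hUr,
    ← pow_add] at h
  have he : d * (k + 1) + d * (d - 1) = d * (d + k) := by
    cases d with
    | zero => simp
    | succ d => simp only [Nat.add_sub_cancel]; ring
  rw [← he, ← h]
  refine Nat.card_congr (Equiv.subtypeEquivRight fun N => and_congr_right fun _ => ?_)
  simp only [Submodule.coe_prodEquivOfIsCompl', ZeroMemClass.coe_zero, add_zero]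
  have hb : ∀ i, ((Basis.span hv i : Submodule.span F (Set.range v)) : V) = v i := fun i => by
    rw [Basis.span_apply]
  constructor
  · rintro ⟨h1, h2⟩ w
    have : N ∘ₗ (Submodule.span F (Set.range v)).subtype
        = (Submodule.span F (Set.range v)).subtype ∘ₗ J := by
      refine (Basis.span hv).ext fun i => ?_
      simp only [LinearMap.comp_apply, Submodule.subtype_apply, hb]
      induction i using Fin.lastCases with
      | last => rw [h2, hJ2]; rfl
      | cast i => rw [h1, hJ1, hb]
    exact LinearMap.congr_fun this w
  · intro h
    refine ⟨fun i => ?_, ?_⟩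
    · rw [← hb, h, hJ1, hb]
    · rw [← hb, h, hJ2]; rfl

lemma card_chain_step {V : Type} [AddCommGroup V] [Module F V] [FiniteDimensional F V]
    {k d : ℕ} (v : Fin (k + 1) → V) (hv : LinearIndependent F v)
    (hd : finrank F V = d + (k + 1))
    (hnil : ∀ U : Submodule F V, finrank F U = d →
      Nat.card {D : End F U // IsNilpotent D} = Nat.card F ^ (d * (d - 1)))
    (c : ℕ)
    (hnext : ∀ v' : Fin (k + 2) → V, LinearIndependent F v' →
      Nat.card {N : End F V // IsNilpotent N ∧ ∀ i : Fin (k + 1), N (v' i.castSucc) = v' i.succ}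
        = c) :
    Nat.card {N : End F V // IsNilpotent N ∧ ∀ i : Fin k, N (v i.castSucc) = v i.succ}
      = Nat.card F ^ (d * (d + k)) +
        (Nat.card F ^ (d + (k + 1)) - Nat.card F ^ (k + 1)) * c := by
  classical
  have : Finite V := Module.finite_of_finite F
  have := Fintype.ofFinite V
  set W := Submodule.span F (Set.range v) with hWdef
  have hcw : ∀ w : V, Nat.card {N : {N : End F V // IsNilpotent N ∧
        ∀ i : Fin k, N (v i.castSucc) = v i.succ} // N.1 (v (Fin.last k)) = w}
      = (if w = 0 then Nat.card F ^ (d * (d + k)) else 0) + (if w ∉ W then c else 0) := by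
    intro w
    by_cases hw : w ∈ W
    · rw [if_neg (not_not.2 hw), add_zero]
      split_ifs with h0
      · subst h0
        rw [← card_closed v hv hd hnil]
        refine Nat.card_congr ((Equiv.subtypeSubtypeEquivSubtypeInter _
          (fun N : End F V => N (v (Fin.last k)) = 0)).trans
          (Equiv.subtypeEquivRight fun N => and_assoc))
      · rw [Nat.card_eq_zero]
        left
        refine ⟨fun ⟨⟨N, hN, hc⟩, hl⟩ => h0 ?_⟩
        rw [← hl]
        exact chain_end v hv N hN hc (by change N _ = w at hl; rw [hl]; exact hw)
    · have h0 : w ≠ 0 := by rintro rfl; exact hw (zero_mem _)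
      rw [if_pos hw, if_neg h0, zero_add,
        ← hnext (Fin.snoc (α := fun _ => V) v w) (linearIndependent_finSnoc.2 ⟨hv, hw⟩)]
      refine Nat.card_congr ((Equiv.subtypeSubtypeEquivSubtypeInter _
          (fun N : End F V => N (v (Fin.last k)) = w)).trans
          (Equiv.subtypeEquivRight fun N => and_assoc.trans (and_congr_right fun _ => ?_)))
      rw [Fin.forall_fin_succ']
      simp only [Fin.snoc_castSucc, Fin.succ_last, Fin.snoc_last, Fin.succ_castSucc]
  rw [← Nat.card_congr (Equiv.sigmaFiberEquiv (fun N : {N : End F V // IsNilpotent N ∧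
        ∀ i : Fin k, N (v i.castSucc) = v i.succ} => N.1 (v (Fin.last k)))), Nat.card_sigma]
  rw [Finset.sum_congr rfl fun w _ => hcw w, Finset.sum_add_distrib, Finset.sum_ite_eq' ]
  simp only [Finset.mem_univ, if_true]
  congr 1
  rw [← Finset.sum_filter, Finset.sum_const, smul_eq_mul]
  congr 1
  have h1 : Nat.card V = Nat.card F ^ (d + (k + 1)) := by
    rw [Module.natCard_eq_pow_finrank (K := F), hd]
  have h2 : Nat.card W = Nat.card F ^ (k + 1) := by
    rw [Module.natCard_eq_pow_finrank (K := F), finrank_span_eq_card hv, Fintype.card_fin]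
  rw [← h1, ← h2, ← Fintype.card_subtype, Fintype.card_subtype_compl, Nat.card_eq_fintype_card,
    Nat.card_eq_fintype_card]

lemma card_nil_of_chain {V : Type} [AddCommGroup V] [Module F V] [FiniteDimensional F V] {n : ℕ}
    (hn : finrank F V = n)
    (h : ∀ (d k : ℕ) (v : Fin (k + 1) → V), LinearIndependent F v → n = d + (k + 1) →
      Nat.card {N : End F V // IsNilpotent N ∧ ∀ i : Fin k, N (v i.castSucc) = v i.succ}
        = Nat.card F ^ (n * d)) :
    Nat.card {N : End F V // IsNilpotent N} = Nat.card F ^ (n * (n - 1)) := by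
  cases n with
  | zero =>
    have := Module.finrank_zero_iff.1 hn
    simp only [zero_mul, pow_zero]
    rw [Nat.card_eq_one_iff_unique]
    refine ⟨⟨fun a b => Subtype.ext (Subsingleton.elim _ _)⟩, ⟨0, IsNilpotent.zero⟩⟩
  | succ m =>
    have : Nontrivial V := Module.nontrivial_of_finrank_pos (R := F) (by omega)
    obtain ⟨x, hx⟩ := exists_ne (0 : V)
    have := h m 0 (fun _ => x) (LinearIndependent.of_subsingleton (ι := Fin 1) (v := fun _ => x) 0 hx) rfl
    rw [Nat.add_sub_cancel, ← this]
    exact Nat.card_congr (Equiv.subtypeEquivRight fun N =>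
      ⟨fun h => ⟨h, fun i => i.elim0⟩, fun h => h.1⟩)

lemma card_chain (n : ℕ) : ∀ (V : Type) [AddCommGroup V] [Module F V] [FiniteDimensional F V],
    finrank F V = n →
    ∀ (d k : ℕ) (v : Fin (k + 1) → V), LinearIndependent F v → n = d + (k + 1) →
      Nat.card {N : End F V // IsNilpotent N ∧ ∀ i : Fin k, N (v i.castSucc) = v i.succ}
        = Nat.card F ^ (n * d) := by
  induction n using Nat.strong_induction_on with
  | _ n IH =>
  intro V _ _ _ hV d
  induction d with
  | zero =>
    intro k v hv hn
    rw [card_chain_step v hv (hV.trans hn)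
      (fun U hU => card_nil_of_chain hU (IH 0 (by omega) U hU)) 0 ?_]
    · simp
    · intro v' hv'
      have := hv'.fintype_card_le_finrank
      rw [Fintype.card_fin] at this
      omega
  | succ d ihd =>
    intro k v hv hn
    rw [card_chain_step v hv (hV.trans hn)
      (fun U hU => card_nil_of_chain hU (IH (d + 1) (by omega) U hU)) (Nat.card F ^ (n * d))
      (fun v' hv' => ihd (k + 1) v' hv' (by omega))]
    rw [Nat.sub_mul, ← pow_add, ← pow_add]
    have e1 : d + 1 + (k + 1) + n * d = n * (d + 1) := by rw [hn]; ring
    have e2 : k + 1 + n * d = (d + 1) * (d + 1 + k) := by rw [hn]; ring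
    rw [e1, e2]
    apply Nat.add_sub_of_le
    apply Nat.pow_le_pow_right Nat.card_pos
    rw [← e1, ← e2]; omega

end FineHerstein



/-- The Fine–Herstein theorem: the number of nilpotent `n × n` matrices over a finite
field with `q` elements is `q^{n(n−1)}`. -/
theorem card_nilpotent_matrices {F : Type} [Field F] [Fintype F] (q : ℕ)
    (hq : Fintype.card F = q) (n : ℕ) :
    Nat.card {A : Matrix (Fin n) (Fin n) F // IsNilpotent A} = q ^ (n * (n - 1)) := by
  have h := card_nil_of_chain (F := F) (V := Fin n → F) (n := n) (by simp)
    (card_chain n (Fin n → F) (by simp))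
  rw [← hq, ← Nat.card_eq_fintype_card, ← h]
  exact Nat.card_congr (Equiv.subtypeEquiv Matrix.toLinAlgEquiv'.toEquiv fun A =>
    (IsNilpotent.map_iff (f := Matrix.toLinAlgEquiv') Matrix.toLinAlgEquiv'.injective).symm)
end

section
/- For every real number q with 0 < q < 1, one has 1 + ∑_{n=1}^∞ q^{n²} / ((1−q)(1−q²)⋯(1−q^n)) = ∏_{n=1}^∞ 1/((1−q^{5n−1})(1−q^{5n−4})) (the first Rogers–Ramanujan identity). -/
open Filter Topology

/-- Reciprocal `q`-factorial extended by zero to negative indices. -/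
noncomputable def rfac (q : ℝ) (n : ℤ) : ℝ :=
  if n < 0 then 0 else (∏ j ∈ Finset.range n.toNat, (1 - q ^ (j + 1)))⁻¹

/-- The signs and triangular powers. -/
noncomputable def tri (q : ℝ) (m : ℤ) : ℝ := (-1) ^ m * q ^ (m * (m - 1) / 2)

lemma rfac_neg (q : ℝ) {n : ℤ} (h : n < 0) : rfac q n = 0 := by simp [rfac, h]

lemma rfac_nat (q : ℝ) (n : ℕ) :
    rfac q n = (∏ j ∈ Finset.range n, (1 - q ^ (j + 1)))⁻¹ := by
  simp [rfac]

lemma rfac_zero (q : ℝ) : rfac q 0 = 1 := by simp [rfac]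

lemma one_sub_pos' {q : ℝ} (h0 : 0 < q) (h1 : q < 1) (n : ℕ) : 0 < 1 - q ^ (n + 1) := by
  have := pow_lt_one₀ h0.le h1 (Nat.succ_ne_zero n)
  simpa using this

lemma rfac_rec {q : ℝ} (h0 : 0 < q) (h1 : q < 1) (n : ℤ) :
    (1 - q ^ n) * rfac q n = rfac q (n - 1) := by
  rcases lt_trichotomy n 0 with h | h | h
  · rw [rfac_neg q h, rfac_neg q (by omega)]; simp
  · subst h; rw [rfac_neg q (n := 0 - 1) (by omega)]; simp
  · obtain ⟨k, rfl⟩ : ∃ k : ℕ, n = ((k + 1 : ℕ) : ℤ) := ⟨(n - 1).toNat, by omega⟩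
    rw [rfac_nat, show (((k + 1 : ℕ) : ℤ) - 1) = (k : ℤ) by push_cast; ring, rfac_nat,
      Finset.prod_range_succ, zpow_natCast, mul_inv]
    have := (one_sub_pos' h0 h1 k).ne'
    field_simp

lemma tri_succ {q : ℝ} (h0 : 0 < q) (m : ℤ) : tri q (m + 1) = - tri q m * q ^ m := by
  unfold tri
  have : (m + 1) * (m + 1 - 1) / 2 = m * (m - 1) / 2 + m := by
    rw [show (m + 1) * (m + 1 - 1) = m * (m - 1) + m * 2 by ring]
    exact Int.add_mul_ediv_right _ _ (by norm_num)
  rw [this, zpow_add₀ h0.ne', zpow_add_one₀ (by norm_num)]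
  ring

/-- summand of the `q`-Vandermonde sum -/
noncomputable def vt (q : ℝ) (m N s : ℤ) : ℝ :=
  q ^ (s ^ 2) * rfac q (N - s) * (rfac q (s - m) * rfac q (s + m))

/-- telescoping partner -/
noncomputable def vg (q : ℝ) (m N s : ℤ) : ℝ :=
  q ^ (N - s + s ^ 2) * rfac q (N - s) * (rfac q (s - 1 - m) * rfac q (s - 1 + m))

lemma vt_tel {q : ℝ} (h0 : 0 < q) (h1 : q < 1) (m N s : ℤ) :
    (1 - q ^ (N - m)) * (1 - q ^ (N + m)) * vt q m N s - vt q m (N - 1) s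
      = vg q m N s - vg q m N (s + 1) := by
  unfold vt vg
  have hq := h0.ne'
  have e1 := rfac_rec h0 h1 (N - s)
  have e2 := rfac_rec h0 h1 (s - m)
  have e3 := rfac_rec h0 h1 (s + m)
  rw [show N - 1 - s = N - s - 1 by ring, show s - 1 - m = s - m - 1 by ring,
    show s - 1 + m = s + m - 1 by ring, show N - (s + 1) = N - s - 1 by ring,
    show s + 1 - 1 - m = s - m by ring, show s + 1 - 1 + m = s + m by ring,
    ← e1, ← e2, ← e3,
    show N - s - 1 + (s + 1) ^ 2 = s ^ 2 + (N + s) by ring, add_comm (N - s) (s ^ 2)]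
  simp only [zpow_add₀ hq, zpow_sub₀ hq]
  have := zpow_ne_zero m hq
  have := zpow_ne_zero s hq
  field_simp
  ring

lemma vsum_rec {q : ℝ} (h0 : 0 < q) (h1 : q < 1) (m : ℤ) (N : ℕ) :
    (1 - q ^ (((N + 1 : ℕ) : ℤ) - m)) * (1 - q ^ (((N + 1 : ℕ) : ℤ) + m)) *
      ∑ s ∈ Finset.range (N + 2), vt q m ((N + 1 : ℕ) : ℤ) s
      = ∑ s ∈ Finset.range (N + 1), vt q m N s := by
  have hlast : vt q m N ((N + 1 : ℕ) : ℤ) = 0 := by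
    unfold vt
    rw [rfac_neg q (n := (N : ℤ) - ((N + 1 : ℕ) : ℤ)) (by push_cast; omega)]; ring
  have h2 : ∑ s ∈ Finset.range (N + 1), vt q m N s = ∑ s ∈ Finset.range (N + 2), vt q m N s := by
    rw [Finset.sum_range_succ _ (N + 1), hlast, add_zero]
  rw [h2, ← sub_eq_zero, Finset.mul_sum, ← Finset.sum_sub_distrib]
  have : ∀ s ∈ Finset.range (N + 2),
      (1 - q ^ (((N + 1 : ℕ) : ℤ) - m)) * (1 - q ^ (((N + 1 : ℕ) : ℤ) + m)) *
        vt q m ((N + 1 : ℕ) : ℤ) s - vt q m N s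
      = (fun s : ℕ => vg q m ((N + 1 : ℕ) : ℤ) s) s
        - (fun s : ℕ => vg q m ((N + 1 : ℕ) : ℤ) s) (s + 1) := by
    intro s _
    have := vt_tel h0 h1 m ((N + 1 : ℕ) : ℤ) s
    rw [show (((N + 1 : ℕ) : ℤ) - 1) = (N : ℤ) by push_cast; ring] at this
    rw [this]; push_cast; rfl
  rw [Finset.sum_congr rfl this, Finset.sum_range_sub']
  have g0 : vg q m ((N + 1 : ℕ) : ℤ) ((0 : ℕ) : ℤ) = 0 := by
    unfold vg
    rcases le_or_gt 0 m with h | h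
    · rw [rfac_neg q (n := ((0 : ℕ) : ℤ) - 1 - m) (by push_cast; omega)]; ring
    · rw [rfac_neg q (n := ((0 : ℕ) : ℤ) - 1 + m) (by push_cast; omega)]; ring
  have g1 : vg q m ((N + 1 : ℕ) : ℤ) ((N + 2 : ℕ) : ℤ) = 0 := by
    unfold vg
    rw [rfac_neg q (n := ((N + 1 : ℕ) : ℤ) - ((N + 2 : ℕ) : ℤ)) (by push_cast; omega)]; ring
  simp only [g0, g1, sub_zero]

lemma one_sub_zpow_ne {q : ℝ} (h0 : 0 < q) (h1 : q < 1) {n : ℤ} (hn : 0 < n) :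
    1 - q ^ n ≠ 0 := by
  obtain ⟨k, rfl⟩ : ∃ k : ℕ, n = ((k + 1 : ℕ) : ℤ) := ⟨(n - 1).toNat, by omega⟩
  rw [zpow_natCast]; exact (one_sub_pos' h0 h1 k).ne'

lemma vsum_pos {q : ℝ} (h0 : 0 < q) (h1 : q < 1) (M k : ℕ) :
    ∑ s ∈ Finset.range (M + k + 1), vt q M ((M + k : ℕ) : ℤ) s
      = q ^ ((M : ℤ) ^ 2) * (rfac q (((M + k : ℕ) : ℤ) - M) * rfac q (((M + k : ℕ) : ℤ) + M)) := by
  induction k with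
  | zero =>
    rw [Finset.sum_range_succ, Finset.sum_eq_zero]
    · simp [vt, rfac_zero]
    · intro s hs
      have : s < M := by simpa using hs
      unfold vt
      rw [rfac_neg q (n := (s : ℤ) - M) (by omega)]; ring
  | succ k ih =>
    have h := vsum_rec h0 h1 M (M + k)
    rw [ih] at h
    have a1 := one_sub_zpow_ne h0 h1 (n := ((M + k + 1 : ℕ) : ℤ) - M) (by push_cast; omega)
    have a2 := one_sub_zpow_ne h0 h1 (n := ((M + k + 1 : ℕ) : ℤ) + M) (by push_cast; omega)
    have e1 := rfac_rec h0 h1 (((M + k + 1 : ℕ) : ℤ) - M)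
    have e2 := rfac_rec h0 h1 (((M + k + 1 : ℕ) : ℤ) + M)
    rw [show ((M + k + 1 : ℕ) : ℤ) - M - 1 = ((M + k : ℕ) : ℤ) - M by push_cast; ring] at e1
    rw [show ((M + k + 1 : ℕ) : ℤ) + M - 1 = ((M + k : ℕ) : ℤ) + M by push_cast; ring] at e2
    rw [← e1, ← e2] at h
    apply mul_left_cancel₀ (mul_ne_zero a1 a2)
    rw [show M + (k + 1) = M + k + 1 by ring, h]
    ring

lemma vsum_eq {q : ℝ} (h0 : 0 < q) (h1 : q < 1) (N : ℕ) (m : ℤ) :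
    ∑ s ∈ Finset.range (N + 1), vt q m N s
      = q ^ (m ^ 2) * (rfac q (N - m) * rfac q (N + m)) := by
  have key : ∀ M : ℕ, ∑ s ∈ Finset.range (N + 1), vt q M N s
      = q ^ ((M : ℤ) ^ 2) * (rfac q (N - M) * rfac q (N + M)) := by
    intro M
    rcases le_or_gt M N with h | h
    · obtain ⟨k, rfl⟩ := Nat.exists_eq_add_of_le h
      exact vsum_pos h0 h1 M k
    · rw [rfac_neg q (n := (N : ℤ) - M) (by omega), Finset.sum_eq_zero]
      · ring
      · intro s hs
        have : s < N + 1 := by simpa using hs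
        unfold vt
        rw [rfac_neg q (n := (s : ℤ) - M) (by omega)]; ring
  obtain ⟨M, rfl | rfl⟩ := m.eq_nat_or_neg
  · exact key M
  · have := key M
    simp only [vt] at this ⊢
    simp only [sub_neg_eq_add, ← sub_eq_add_neg, neg_sq]
    rw [mul_comm (rfac q (N + M)), ← this]
    exact Finset.sum_congr rfl fun s _ => by ring

/-- central product of reciprocal factorials -/
noncomputable def bb (q : ℝ) (s m : ℤ) : ℝ := rfac q (s - m) * rfac q (s + m)

lemma bb_zero (q : ℝ) (s m : ℤ) (h : m ∉ Finset.Icc (-s) s) : bb q s m = 0 := by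
  unfold bb
  rw [Finset.mem_Icc, not_and_or] at h
  rcases h with h | h
  · rw [rfac_neg q (n := s + m) (by omega)]; ring
  · rw [rfac_neg q (n := s - m) (by omega)]; ring

lemma summable_bb (q : ℝ) (s : ℤ) (f : ℤ → ℝ) : Summable (fun m => f m * bb q s m) :=
  summable_of_ne_finset_zero (s := Finset.Icc (-s) s) fun m hm => by rw [bb_zero q s m hm, mul_zero]

/-- Bailey lemma, finite form -/
lemma bailey {q : ℝ} (h0 : 0 < q) (h1 : q < 1) (α : ℤ → ℝ) (N : ℕ) :
    ∑' m : ℤ, (α m * q ^ (m ^ 2)) * bb q N m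
      = ∑ s ∈ Finset.range (N + 1), q ^ (s ^ 2) * rfac q ((N : ℤ) - s) *
          ∑' m : ℤ, α m * bb q s m := by
  have : ∀ s ∈ Finset.range (N + 1), q ^ (s ^ 2) * rfac q ((N : ℤ) - s) *
          ∑' m : ℤ, α m * bb q s m
      = ∑' m : ℤ, (q ^ (s ^ 2) * rfac q ((N : ℤ) - s)) * (α m * bb q s m) := by
    intro s _; rw [tsum_mul_left]
  rw [Finset.sum_congr rfl this, ← Summable.tsum_finsetSum
    (fun (s : ℕ) _ => (summable_bb q (s : ℤ) α).mul_left (q ^ (s ^ 2) * rfac q ((N : ℤ) - s)))]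
  congr 1; ext m
  have := vsum_eq h0 h1 N m
  rw [mul_assoc, bb, ← this, Finset.mul_sum]
  refine Finset.sum_congr rfl fun s _ => ?_
  unfold vt bb
  rw [show ((s : ℤ) ^ 2) = ((s ^ 2 : ℕ) : ℤ) by push_cast; rfl, zpow_natCast]
  ring

lemma jtp_alg {q z A B Z T R S : ℝ} (hq : q ≠ 0) (hz : z ≠ 0) (hB : B ≠ 0) :
    (1 - A * A) * (1 - A * A / q) * (T * Z * (R * S)) =
    (1 + A * A / q) * (T * Z * ((1 - A / B) * R * ((1 - A * B) * S))) -
      z * (A / q) * (-T * (B / q)⁻¹ * (Z * z⁻¹) * (R * ((1 - A * B / q) * ((1 - A * B) * S)))) -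
      A / z * (-T * B * (Z * z) * ((1 - A / B / q) * ((1 - A / B) * R) * S)) := by
  have : (1 - A * A) * (1 - A * A / q) =
    (1 + A * A / q) * ((1 - A / B) * (1 - A * B)) +
      A / B * ((1 - A * B / q) * (1 - A * B)) +
      A * B * ((1 - A / B / q) * (1 - A / B)) := by
    field_simp
    ring
  rw [this]
  have e1 : z * (A / q) * (-T * (B / q)⁻¹ * (Z * z⁻¹) * (R * ((1 - A * B / q) * ((1 - A * B) * S))))
    = - (A / B * ((1 - A * B / q) * (1 - A * B)) * (T * Z * (R * S))) := by
    rw [inv_div, show z * (A / q) * (-T * (q / B) * (Z * z⁻¹) *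
      (R * ((1 - A * B / q) * ((1 - A * B) * S)))) = (z * z⁻¹) * (q / q) * -(A / B * ((1 - A * B / q) * (1 - A * B)) * (T * Z * (R * S))) by ring,
      mul_inv_cancel₀ hz, div_self hq]
    ring
  have e2 : A / z * (-T * B * (Z * z) * ((1 - A / B / q) * ((1 - A / B) * R) * S))
    = - (A * B * ((1 - A / B / q) * (1 - A / B)) * (T * Z * (R * S))) := by
    rw [show A / z * (-T * B * (Z * z) * ((1 - A / B / q) * ((1 - A / B) * R) * S)) =
      (z / z) * - (A * B * ((1 - A / B / q) * (1 - A / B)) * (T * Z * (R * S))) by ring, div_self hz]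
    ring
  rw [e1, e2]
  ring

lemma jtp_term {q : ℝ} (h0 : 0 < q) (h1 : q < 1) {z : ℝ} (hz : z ≠ 0) (s m : ℤ) :
    (1 - q ^ (2 * s)) * (1 - q ^ (2 * s - 1)) * ((tri q m * z ^ m) * bb q s m) =
    ((1 + q ^ (2 * s - 1)) * ((tri q m * z ^ m) * bb q (s - 1) m)
      - z * q ^ (s - 1) * ((tri q (m - 1) * z ^ (m - 1)) * bb q (s - 1) (m - 1)))
      - q ^ s / z * ((tri q (m + 1) * z ^ (m + 1)) * bb q (s - 1) (m + 1)) := by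
  have hq := h0.ne'
  have t1 := tri_succ h0 m
  have t2 := tri_succ h0 (m - 1)
  rw [sub_add_cancel] at t2
  have t2' : tri q (m - 1) = - tri q m * (q ^ (m - 1))⁻¹ := by
    rw [t2]; have := zpow_ne_zero (m - 1) hq; field_simp
  unfold bb
  have e1 := rfac_rec h0 h1 (s - m)
  have e2 := rfac_rec h0 h1 (s - m - 1)
  have e3 := rfac_rec h0 h1 (s + m)
  have e4 := rfac_rec h0 h1 (s + m - 1)
  rw [t1, t2', show s - 1 - (m - 1) = s - m by ring, show s - 1 + (m - 1) = s + m - 1 - 1 by ring,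
    show s - 1 - (m + 1) = s - m - 1 - 1 by ring, show s - 1 + (m + 1) = s + m by ring,
    show s - 1 - m = s - m - 1 by ring, show s - 1 + m = s + m - 1 by ring,
    ← e2, ← e4, ← e1, ← e3, zpow_add_one₀ hz, zpow_sub_one₀ hz, two_mul]
  simp only [zpow_add₀ hq, zpow_sub₀ hq, zpow_one]
  exact jtp_alg hq hz (zpow_ne_zero m hq)

lemma shift_sum {t : ℤ → ℝ} (st : Summable t) (a b c : ℝ) :
    ∑' m, ((a * t m - b * t (m - 1)) - c * t (m + 1)) = (a - b - c) * ∑' m, t m := by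
  have sp : Summable fun m => t (m + 1) := (Equiv.addRight (1 : ℤ)).summable_iff.mpr st
  have sm : Summable fun m => t (m - 1) := (Equiv.subRight (1 : ℤ)).summable_iff.mpr st
  have ep : ∑' m, t (m + 1) = ∑' m, t m := (Equiv.addRight (1 : ℤ)).tsum_eq t
  have em : ∑' m, t (m - 1) = ∑' m, t m := (Equiv.subRight (1 : ℤ)).tsum_eq t
  rw [Summable.tsum_sub ((st.mul_left _).sub (sm.mul_left _)) (sp.mul_left _),
    Summable.tsum_sub (st.mul_left _) (sm.mul_left _), tsum_mul_left, tsum_mul_left,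
    tsum_mul_left, ep, em]
  ring

/-- finite Jacobi triple product, recurrence -/
lemma jtp_rec {q : ℝ} (h0 : 0 < q) (h1 : q < 1) {z : ℝ} (hz : z ≠ 0) (s : ℤ) :
    (1 - q ^ (2 * s)) * (1 - q ^ (2 * s - 1)) * ∑' m : ℤ, (tri q m * z ^ m) * bb q s m
    = (1 - z * q ^ (s - 1)) * (1 - q ^ s / z) *
      ∑' m : ℤ, (tri q m * z ^ m) * bb q (s - 1) m := by
  have hc : (1 - z * q ^ (s - 1)) * (1 - q ^ s / z)
      = 1 + q ^ (2 * s - 1) - z * q ^ (s - 1) - q ^ s / z := by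
    rw [show 2 * s - 1 = s + (s - 1) by ring, zpow_add₀ h0.ne']
    field_simp
    ring
  rw [hc, ← shift_sum (summable_bb q (s - 1) fun m => tri q m * z ^ m), ← tsum_mul_left]
  exact tsum_congr fun m => jtp_term h0 h1 hz s m

lemma bb_zero_left (q : ℝ) (f : ℤ → ℝ) : ∑' m : ℤ, f m * bb q 0 m = f 0 := by
  rw [tsum_eq_single 0]
  · simp [bb, rfac_zero]
  · intro m hm
    rw [bb_zero q 0 m (by simp; omega), mul_zero]

lemma jtp_fin {q : ℝ} (h0 : 0 < q) (h1 : q < 1) {z : ℝ} (hz : z ≠ 0) (s : ℕ) :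
    ∑' m : ℤ, (tri q m * z ^ m) * bb q s m
      = (∏ j ∈ Finset.range s, ((1 - z * q ^ j) * (1 - q ^ (j + 1) / z))) *
        rfac q ((2 * s : ℕ) : ℤ) := by
  induction s with
  | zero => 
    rw [Nat.cast_zero, bb_zero_left]; simp [tri, rfac_zero]
  | succ s ih =>
    have h := jtp_rec h0 h1 hz ((s + 1 : ℕ) : ℤ)
    rw [show ((s + 1 : ℕ) : ℤ) - 1 = (s : ℤ) by push_cast; ring, ih] at h
    have a1 := one_sub_zpow_ne h0 h1 (n := 2 * ((s + 1 : ℕ) : ℤ)) (by push_cast; omega)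
    have a2 := one_sub_zpow_ne h0 h1 (n := 2 * ((s + 1 : ℕ) : ℤ) - 1) (by push_cast; omega)
    have e1 := rfac_rec h0 h1 (2 * ((s + 1 : ℕ) : ℤ))
    have e2 := rfac_rec h0 h1 (2 * ((s + 1 : ℕ) : ℤ) - 1)
    rw [show 2 * ((s + 1 : ℕ) : ℤ) - 1 - 1 = ((2 * s : ℕ) : ℤ) by push_cast; ring, ← e1] at e2
    rw [← e2, zpow_natCast, zpow_natCast] at h
    apply mul_left_cancel₀ (mul_ne_zero a1 a2)
    rw [h, Finset.prod_range_succ, show ((2 * (s + 1) : ℕ) : ℤ) = 2 * ((s + 1 : ℕ) : ℤ) by push_cast; ring]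
    ring

lemma unit_pair {q : ℝ} (h0 : 0 < q) (h1 : q < 1) (s : ℕ) :
    ∑' m : ℤ, tri q m * bb q s m = if s = 0 then 1 else 0 := by
  have h := jtp_fin h0 h1 one_ne_zero s
  simp only [one_zpow, mul_one] at h
  rw [h]
  split_ifs with hs
  · subst hs; simp [rfac_zero]
  · rw [Finset.prod_eq_zero (i := 0) (by simpa using Nat.pos_of_ne_zero hs) (by simp), zero_mul]

lemma pair_one {q : ℝ} (h0 : 0 < q) (h1 : q < 1) (N : ℕ) :
    ∑' m : ℤ, (tri q m * q ^ (m ^ 2)) * bb q N m = rfac q N := by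
  rw [bailey h0 h1, Finset.sum_eq_single 0]
  · rw [unit_pair h0 h1]; simp
  · intro s _ hs
    rw [unit_pair h0 h1, if_neg hs, mul_zero]
  · simp

lemma rr_fin {q : ℝ} (h0 : 0 < q) (h1 : q < 1) (N : ℕ) :
    ∑' m : ℤ, (tri q m * q ^ (m ^ 2) * q ^ (m ^ 2)) * bb q N m
      = ∑ s ∈ Finset.range (N + 1), q ^ (s ^ 2) * rfac q ((N : ℤ) - s) * rfac q s := by
  rw [bailey h0 h1]
  exact Finset.sum_congr rfl fun s _ => by rw [pair_one h0 h1]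

/-- limit of the reciprocal factorials -/
noncomputable def rinf (q : ℝ) : ℝ := (∏' j : ℕ, (1 - q ^ (j + 1)))⁻¹

lemma summable_aux {q : ℝ} (h0 : 0 < q) (h1 : q < 1) : Summable fun j : ℕ => ‖-q ^ (j + 1)‖ := by
  simp only [norm_neg, norm_pow, Real.norm_eq_abs, abs_of_pos h0]
  exact (summable_nat_add_iff 1).mpr (summable_geometric_of_lt_one h0.le h1)

lemma tprod_ne {q : ℝ} (h0 : 0 < q) (h1 : q < 1) : ∏' j : ℕ, (1 - q ^ (j + 1)) ≠ 0 := by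
  have := tprod_one_add_ne_zero_of_summable (f := fun j : ℕ => -q ^ (j + 1))
    (fun j => by rw [← sub_eq_add_neg]; exact (one_sub_pos' h0 h1 j).ne') (summable_aux h0 h1)
  simpa [← sub_eq_add_neg] using this

lemma rinf_ne {q : ℝ} (h0 : 0 < q) (h1 : q < 1) : rinf q ≠ 0 := inv_ne_zero (tprod_ne h0 h1)

lemma rfac_tendsto_nat {q : ℝ} (h0 : 0 < q) (h1 : q < 1) :
    Tendsto (fun n : ℕ => rfac q n) atTop (𝓝 (rinf q)) := by
  have hm : Multipliable fun j : ℕ => (1 - q ^ (j + 1)) := by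
    have := multipliable_one_add_of_summable (summable_aux h0 h1)
    simpa [← sub_eq_add_neg] using this
  simp only [rfac_nat]
  exact hm.hasProd.tendsto_prod_nat.inv₀ (tprod_ne h0 h1)

lemma rfac_tendsto {q : ℝ} (h0 : 0 < q) (h1 : q < 1) : Tendsto (rfac q) atTop (𝓝 (rinf q)) := by
  have : Tendsto Int.toNat atTop atTop := by
    refine tendsto_atTop.mpr fun b => ?_
    filter_upwards [eventually_ge_atTop (b : ℤ)] with n hn
    omega
  refine ((rfac_tendsto_nat h0 h1).comp this).congr' ?_
  filter_upwards [eventually_ge_atTop 0] with n hn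
  simp [Int.toNat_of_nonneg hn]

lemma rfac_nonneg {q : ℝ} (h0 : 0 < q) (h1 : q < 1) (n : ℤ) : 0 ≤ rfac q n := by
  unfold rfac
  split_ifs
  · rfl
  · exact inv_nonneg.mpr (Finset.prod_nonneg fun j _ => (one_sub_pos' h0 h1 j).le)

lemma rfac_mono {q : ℝ} (h0 : 0 < q) (h1 : q < 1) : Monotone (rfac q) := by
  refine monotone_int_of_le_succ fun n => ?_
  rcases lt_or_ge n 0 with h | h
  · rw [rfac_neg q h]; exact rfac_nonneg h0 h1 _
  · have := rfac_rec h0 h1 (n + 1)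
    rw [add_sub_cancel_right] at this
    rw [← this]
    have := zpow_pos h0 (n + 1)
    nlinarith [rfac_nonneg h0 h1 (n + 1)]

lemma rfac_le {q : ℝ} (h0 : 0 < q) (h1 : q < 1) (n : ℤ) : rfac q n ≤ rinf q :=
  (rfac_mono h0 h1).ge_of_tendsto (rfac_tendsto h0 h1) n

lemma rinf_nonneg {q : ℝ} (h0 : 0 < q) (h1 : q < 1) : 0 ≤ rinf q :=
  (rfac_nonneg h0 h1 0).trans (rfac_le h0 h1 0)

lemma lim_bb {q : ℝ} (h0 : 0 < q) (h1 : q < 1) {α : ℤ → ℝ} (hα : Summable fun m => ‖α m‖) :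
    Tendsto (fun N : ℕ => ∑' m : ℤ, α m * bb q N m) atTop
      (𝓝 (∑' m : ℤ, α m * (rinf q * rinf q))) := by
  refine tendsto_tsum_of_dominated_convergence (bound := fun m => ‖α m‖ * (rinf q * rinf q))
    (hα.mul_right _) ?_ ?_
  · intro m
    have c : Tendsto (fun N : ℕ => (N : ℤ)) atTop atTop := tendsto_natCast_atTop_atTop
    refine Tendsto.const_mul _ (Tendsto.mul ?_ ?_)
    · exact (rfac_tendsto h0 h1).comp (tendsto_atTop_add_const_right _ (-m) c)
    · exact (rfac_tendsto h0 h1).comp (tendsto_atTop_add_const_right _ m c)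
  · refine Eventually.of_forall fun N m => ?_
    rw [norm_mul, bb, norm_mul, Real.norm_of_nonneg (rfac_nonneg h0 h1 _),
      Real.norm_of_nonneg (rfac_nonneg h0 h1 _)]
    gcongr
    all_goals first | exact rfac_le h0 h1 _ | exact rfac_nonneg h0 h1 _ | exact rinf_nonneg h0 h1

/-- theta coefficients -/
noncomputable def th (q : ℝ) (m : ℤ) : ℝ := tri q m * q ^ (m ^ 2) * q ^ (m ^ 2)

lemma two_tri (m : ℤ) : 2 * (m * (m - 1) / 2) = m * (m - 1) := by
  have : 2 ∣ m * (m - 1) := by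
    have := Int.even_mul_pred_self m
    exact this.two_dvd
  exact Int.mul_ediv_cancel' this

lemma th_eq {q : ℝ} (h0 : 0 < q) (m : ℤ) : th q m = tri (q ^ 5) m * (q ^ 2) ^ m := by
  unfold th tri
  have h := two_tri m
  rw [← zpow_natCast q 5, ← zpow_natCast q 2, ← zpow_mul, ← zpow_mul, mul_assoc, mul_assoc,
    mul_assoc, ← zpow_add₀ h0.ne', ← zpow_add₀ h0.ne', ← zpow_add₀ h0.ne']
  congr 2
  push_cast
  nlinarith

lemma th_summable {q : ℝ} (h0 : 0 < q) (h1 : q < 1) : Summable fun m => ‖th q m‖ := by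
  have hs : Summable fun m : ℤ => q ^ m.natAbs := by
    apply Summable.of_nat_of_neg
    · simpa using summable_geometric_of_lt_one h0.le h1
    · simpa using summable_geometric_of_lt_one h0.le h1
  refine Summable.of_nonneg_of_le (fun _ => norm_nonneg _) (fun m => ?_) hs
  unfold th tri
  rw [mul_assoc, mul_assoc, ← zpow_add₀ h0.ne', ← zpow_add₀ h0.ne', norm_mul, norm_zpow, norm_neg,
    norm_one, one_zpow, one_mul, Real.norm_of_nonneg (zpow_pos h0 _).le, ← zpow_natCast]
  apply zpow_le_zpow_right_of_le_one₀ h0 h1.le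
  have h := two_tri m
  rw [Int.natCast_natAbs]
  have h3 : |m| ≤ m ^ 2 := by rw [← sq_abs]; exact Int.le_self_sq _
  have h4 : 0 ≤ m * (m - 1) := by
    rcases le_or_gt m 0 with h | h
    · nlinarith
    · nlinarith
  nlinarith [sq_nonneg m]

lemma rr_lim {q : ℝ} (h0 : 0 < q) (h1 : q < 1) :
    ∑' s : ℕ, q ^ (s ^ 2) * rfac q s = rinf q * ∑' m : ℤ, th q m := by
  have A := lim_bb h0 h1 (th_summable h0 h1)
  have B : Tendsto (fun N : ℕ => ∑' s : ℕ, q ^ (s ^ 2) * rfac q ((N : ℤ) - s) * rfac q s) atTop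
      (𝓝 (∑' s : ℕ, q ^ (s ^ 2) * rinf q * rfac q s)) := by
    refine tendsto_tsum_of_dominated_convergence (bound := fun s => q ^ s * rinf q * rinf q) ?_ ?_ ?_
    · exact ((summable_geometric_of_lt_one h0.le h1).mul_right _).mul_right _
    · intro s
      have c : Tendsto (fun N : ℕ => (N : ℤ)) atTop atTop := tendsto_natCast_atTop_atTop
      exact (((rfac_tendsto h0 h1).comp
        (tendsto_atTop_add_const_right _ (-(s : ℤ)) c)).const_mul _).mul_const _
    · refine Eventually.of_forall fun N s => ?_
      have r1 := rfac_nonneg h0 h1 ((N : ℤ) - s)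
      have r2 := rfac_nonneg h0 h1 s
      have r3 := rinf_nonneg h0 h1
      rw [Real.norm_of_nonneg (by positivity)]
      have hp : q ^ (s ^ 2) ≤ q ^ s :=
        pow_le_pow_of_le_one h0.le h1.le (Nat.le_self_pow two_ne_zero s)
      gcongr
      · exact rfac_le h0 h1 _
      · exact rfac_le h0 h1 _
  have E : (fun N : ℕ => ∑' s : ℕ, q ^ (s ^ 2) * rfac q ((N : ℤ) - s) * rfac q s)
      = fun N : ℕ => ∑' m : ℤ, th q m * bb q N m := by
    ext N
    simp only [th]
    rw [rr_fin h0 h1, tsum_eq_sum]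
    intro s hs
    rw [Finset.mem_range] at hs
    rw [rfac_neg q (n := (N : ℤ) - s) (by omega)]; ring
  rw [E] at B
  have := tendsto_nhds_unique A B
  rw [tsum_mul_right] at this
  have e : ∀ s : ℕ, q ^ (s ^ 2) * rinf q * rfac q s = rinf q * (q ^ (s ^ 2) * rfac q s) :=
    fun s => by ring
  simp only [e] at this
  rw [tsum_mul_left] at this
  apply mul_left_cancel₀ (rinf_ne h0 h1)
  rw [← this]; ring

lemma jtp_lim {q : ℝ} (h0 : 0 < q) (h1 : q < 1) :
    Tendsto (fun N : ℕ => (∏ j ∈ Finset.range N, ((1 - q ^ (5 * j + 2)) * (1 - q ^ (5 * j + 3)))) *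
      rfac (q ^ 5) ((2 * N : ℕ) : ℤ)) atTop
      (𝓝 ((∑' m : ℤ, th q m) * (rinf (q ^ 5) * rinf (q ^ 5)))) := by
  have p0 : 0 < q ^ 5 := by positivity
  have p1 : q ^ 5 < 1 := pow_lt_one₀ h0.le h1 (by norm_num)
  have A := lim_bb p0 p1 (th_summable h0 h1)
  rw [tsum_mul_right] at A
  refine A.congr fun N => ?_
  simp only [th_eq h0]
  rw [jtp_fin p0 p1 (by positivity)]
  congr 1
  refine Finset.prod_congr rfl fun j _ => ?_
  congr 2
  · rw [← pow_mul, ← pow_add, add_comm]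
  · rw [← pow_mul, div_eq_iff (by positivity), ← pow_add]
    congr 1

lemma prod_five {q : ℝ} (h0 : 0 < q) (h1 : q < 1) (N : ℕ) :
    ∏ n ∈ Finset.range N, ((1 - q ^ (5 * n + 4)) * (1 - q ^ (5 * n + 1)))⁻¹
      = (∏ j ∈ Finset.range N, ((1 - q ^ (5 * j + 2)) * (1 - q ^ (5 * j + 3)))) *
        rfac q ((5 * N : ℕ) : ℤ) / rfac (q ^ 5) (N : ℤ) := by
  rw [rfac_nat, rfac_nat]
  induction N with
  | zero => simp
  | succ N ih =>
    rw [Finset.prod_range_succ, ih, show 5 * (N + 1) = 5 * N + 1 + 1 + 1 + 1 + 1 by ring]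
    simp only [Finset.prod_range_succ]
    have a0 := (one_sub_pos' h0 h1 (5 * N)).ne'
    have a1 := (one_sub_pos' h0 h1 (5 * N + 1)).ne'
    have a2 := (one_sub_pos' h0 h1 (5 * N + 2)).ne'
    have a3 := (one_sub_pos' h0 h1 (5 * N + 3)).ne'
    have a4 := (one_sub_pos' h0 h1 (5 * N + 4)).ne'
    have b : (q ^ 5) ^ (N + 1) = q ^ (5 * N + 4 + 1) := by rw [← pow_mul]; congr 1
    rw [b]
    have c : ∏ x ∈ Finset.range (5 * N), (1 - q ^ (x + 1)) ≠ 0 :=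
      Finset.prod_ne_zero_iff.mpr fun x _ => (one_sub_pos' h0 h1 x).ne'
    simp only [add_assoc, Nat.reduceAdd, mul_inv, div_inv_eq_mul] at *
    field_simp

lemma rhs_multipliable {q : ℝ} (h0 : 0 < q) (h1 : q < 1) :
    Multipliable fun n : ℕ => ((1 - q ^ (5 * n + 4)) * (1 - q ^ (5 * n + 1)))⁻¹ := by
  have key : ∀ k : ℕ, Multipliable fun n : ℕ => (1 - q ^ (5 * n + (k + 1)))⁻¹ := by
    intro k
    have hs : Summable fun n : ℕ => ‖-q ^ (5 * n + (k + 1))‖ := by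
      have := (summable_aux h0 h1).comp_injective (i := fun n : ℕ => 5 * n + k)
        (fun a b h => by simpa using h)
      exact this
    have hm := multipliable_one_add_of_summable hs
    have hn := tprod_one_add_ne_zero_of_summable (f := fun n : ℕ => -q ^ (5 * n + (k + 1)))
      (fun j => by rw [← sub_eq_add_neg]; exact (one_sub_pos' h0 h1 (5 * j + k)).ne') hs
    simpa [← sub_eq_add_neg] using hm.inv₀ hn
  simp only [mul_inv]
  exact (key 3).mul (key 0)

/-- The first Rogers–Ramanujan identity: for `0 < q < 1`,
`1 + ∑_{n=1}^∞ q^{n²}/((1−q)(1−q²)⋯(1−qⁿ)) = ∏_{n=1}^∞ 1/((1−q^{5n−1})(1−q^{5n−4}))`. -/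
theorem rogers_ramanujan_first (q : ℝ) (h0 : 0 < q) (h1 : q < 1) :
    1 + ∑' n : ℕ, q ^ ((n + 1) ^ 2) / ∏ j ∈ Finset.range (n + 1), (1 - q ^ (j + 1)) =
      ∏' n : ℕ, ((1 - q ^ (5 * n + 4)) * (1 - q ^ (5 * n + 1)))⁻¹ := by
  have p0 : 0 < q ^ 5 := by positivity
  have p1 : q ^ 5 < 1 := pow_lt_one₀ h0.le h1 (by norm_num)
  have hsum : Summable fun s : ℕ => q ^ (s ^ 2) * rfac q s := by
    refine Summable.of_nonneg_of_le (fun s => mul_nonneg (by positivity) (rfac_nonneg h0 h1 _))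
      (fun s => ?_) ((summable_geometric_of_lt_one h0.le h1).mul_right (rinf q))
    exact mul_le_mul (pow_le_pow_of_le_one h0.le h1.le (Nat.le_self_pow two_ne_zero s))
      (rfac_le h0 h1 _) (rfac_nonneg h0 h1 _) (by positivity)
  have hL : 1 + ∑' n : ℕ, q ^ ((n + 1) ^ 2) / ∏ j ∈ Finset.range (n + 1), (1 - q ^ (j + 1))
      = ∑' s : ℕ, q ^ (s ^ 2) * rfac q s := by
    rw [hsum.tsum_eq_zero_add]
    congr 1
    · simp [rfac_zero]
  rw [hL, rr_lim h0 h1]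
  have hR := (rhs_multipliable h0 h1).hasProd.tendsto_prod_nat
  refine tendsto_nhds_unique ?_ hR
  have n5 := rinf_ne p0 p1
  have t2 : Tendsto (fun N : ℕ => rfac (q ^ 5) ((2 * N : ℕ) : ℤ)) atTop (𝓝 (rinf (q ^ 5))) :=
    (rfac_tendsto_nat p0 p1).comp
      (tendsto_atTop_mono (fun n => by simp only [id]; omega) tendsto_id)
  have t5 : Tendsto (fun N : ℕ => rfac q ((5 * N : ℕ) : ℤ)) atTop (𝓝 (rinf q)) :=
    (rfac_tendsto_nat h0 h1).comp
      (tendsto_atTop_mono (fun n => by simp only [id]; omega) tendsto_id)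
  have T := (((jtp_lim h0 h1).div t2 n5).mul t5).div (rfac_tendsto_nat p0 p1) n5
  have e : (∑' m : ℤ, th q m) * (rinf (q ^ 5) * rinf (q ^ 5)) / rinf (q ^ 5) * rinf q / rinf (q ^ 5)
      = rinf q * ∑' m : ℤ, th q m := by field_simp
  rw [e] at T
  refine T.congr fun N => ?_
  have hne : rfac (q ^ 5) ((2 * N : ℕ) : ℤ) ≠ 0 := by
    rw [rfac_nat]
    exact inv_ne_zero (Finset.prod_ne_zero_iff.mpr fun x _ => (one_sub_pos' p0 p1 x).ne')
  rw [prod_five h0 h1]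
  simp only [Pi.div_apply]
  rw [mul_div_cancel_right₀ _ hne]
end
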